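/- arXiv:1605.06819 — 7 statements merged into one kernel-verified Lean document; each statement's English description precedes it below -/
import Mathlib

section
/- Let X and Y be real random variables with characteristic functions φ and ψ respectively. Assume (H1): there exist p ∈ ℕ, C' > 0 and 0 < ε < 1 such that |ψ(ξ) − φ(ξ)| ≤ C' ε |ξ|^p for all ξ ∈ ℝ; and (H2): there exist λ > 0, C > 0 and α > 0 such that for all A > 0, P(|X| > A) ≤ C e^{−λ A^α} and P(|Y| > A) ≤ C e^{−λ A^α}. Then there exists a constant K_p > 0 depending only on p such that W_{p+1}(X, Y) ≤ 2ε [ C + (2^{p−1} √10 C' K_p / π) √( 1 + (λ^{−1} log(1/ε))^{1/α} ) ]. -/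
open MeasureTheory ProbabilityTheory Complex

section

open scoped FourierTransform ContDiff Convolution

lemma HasCompactSupport.iteratedDeriv {f : ℝ → ℂ} (hf : HasCompactSupport f) (n : ℕ) :
    HasCompactSupport (iteratedDeriv n f) := by
  refine hf.mono' fun x hx ↦ support_iteratedFDeriv_subset (𝕜 := ℝ) n ?_
  rwa [Function.mem_support, ← norm_ne_zero_iff, norm_iteratedFDeriv_eq_norm_iteratedDeriv,
    norm_ne_zero_iff]

lemma iteratedDeriv_eq_zero_of_lt_abs {f : ℝ → ℂ} {R : ℝ} (hf : ∀ x, R < |x| → f x = 0) (n : ℕ)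
    {x : ℝ} (hx : R < |x|) : iteratedDeriv n f x = 0 := by
  have h : f =ᶠ[nhds x] fun _ ↦ 0 := by
    filter_upwards [(isOpen_lt continuous_const continuous_abs).mem_nhds hx] with y hy
    exact hf y hy
  rw [h.iteratedDeriv_eq n, iteratedDeriv_const]
  simp

lemma HasCompactSupport.of_eq_zero_of_lt_abs {f : ℝ → ℂ} {R : ℝ}
    (hf : ∀ x, R < |x| → f x = 0) : HasCompactSupport f :=
  HasCompactSupport.intro (isCompact_Icc (a := -R) (b := R)) fun x hx ↦
    hf x (by simpa [← abs_le] using hx)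

lemma integral_norm_sq_le_of_eq_zero_of_lt_abs {f : ℝ → ℂ} {R M : ℝ} (hR : 0 ≤ R)
    (hf : ∀ x, R < |x| → f x = 0) (hM : ∀ x, ‖f x‖ ≤ M) :
    ∫ x, ‖f x‖ ^ 2 ≤ M ^ 2 * (2 * R) := by
  rw [← setIntegral_eq_integral_of_forall_compl_eq_zero (s := Set.Icc (-R) R) fun x hx ↦ ?_]
  · refine (Real.le_norm_self _).trans
      ((norm_setIntegral_le_of_norm_le_const (C := M ^ 2) measure_Icc_lt_top fun x _ ↦ ?_).trans_eq ?_)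
    · rw [norm_pow, norm_norm]
      gcongr
      exact hM x
    · rw [Real.volume_real_Icc_of_le (by linarith)]
      ring
  · simp [hf x (by simpa [← abs_le] using hx)]

lemma ContDiff.iteratedDeriv_infty {f : ℝ → ℂ} (hf : ContDiff ℝ ∞ f) (n : ℕ) :
    ContDiff ℝ ∞ (iteratedDeriv n f) := by
  rw [iteratedDeriv_eq_iterate]
  exact hf.iterate_deriv n

lemma integrable_fourier_of_hasCompactSupport {f : ℝ → ℂ} (hf : ContDiff ℝ ∞ f)
    (hc : HasCompactSupport f) :
    Integrable (𝓕 f) := by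
  simpa [SchwartzMap.fourier_coe] using! (𝓕 (hc.toSchwartzMap hf)).integrable (μ := volume)

lemma norm_fourier_iteratedDeriv {f : ℝ → ℂ} (hf : ContDiff ℝ ∞ f)
    (hc : HasCompactSupport f) (n : ℕ) (ξ : ℝ) :
    ‖𝓕 (iteratedDeriv n f) ξ‖ = |2 * Real.pi * ξ| ^ n * ‖𝓕 f ξ‖ := by
  rw [Real.fourier_iteratedDeriv (N := ⊤) hf (fun k _ ↦ ?_) le_top]
  · simp [abs_mul, abs_of_pos Real.pi_pos]
  · exact (hf.continuous_iteratedDeriv k (mod_cast le_top)).integrable_of_hasCompactSupport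
      (hc.iteratedDeriv k)

lemma integrable_norm_sq_fourier_of_hasCompactSupport {f : ℝ → ℂ} (hf : ContDiff ℝ ∞ f)
    (hc : HasCompactSupport f) :
    Integrable fun ξ ↦ ‖𝓕 f ξ‖ ^ 2 := by
  have h := ((𝓕 (hc.toSchwartzMap hf)).memLp 2 volume).integrable_norm_pow (by norm_num)
  simpa [SchwartzMap.fourier_coe] using! h

lemma integral_norm_sq_fourier_of_hasCompactSupport {f : ℝ → ℂ} (hf : ContDiff ℝ ∞ f)
    (hc : HasCompactSupport f) :
    ∫ ξ, ‖𝓕 f ξ‖ ^ 2 = ∫ x, ‖f x‖ ^ 2 := by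
  simpa [SchwartzMap.fourier_coe] using! (hc.toSchwartzMap hf).integral_norm_sq_fourier

/-- The weight `|2πξ|ᵖ` is integrated against `|𝓕 f|` by writing
`|𝓕 f| |u|ᵖ ≤ (t / 2) |𝓕 f|² |u|²ᵖ (1 + u²) + (1 / 2t) (1 + u²)⁻¹` with `u = 2πξ`, and applying
Plancherel to the first term. -/
lemma integral_norm_fourier_mul_le {f : ℝ → ℂ} (hf : ContDiff ℝ ∞ f)
    (hc : HasCompactSupport f) {p : ℕ} {R M t : ℝ} (hR : 0 ≤ R) (ht : 0 < t)
    (hfR : ∀ x, R < |x| → f x = 0) (hp : ∀ x, ‖iteratedDeriv p f x‖ ≤ M)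
    (hp1 : ∀ x, ‖iteratedDeriv (p + 1) f x‖ ≤ M) :
    Integrable (fun ξ ↦ ‖𝓕 f ξ‖ * |2 * Real.pi * ξ| ^ p) ∧
    ∫ ξ, ‖𝓕 f ξ‖ * |2 * Real.pi * ξ| ^ p ≤ t * (M ^ 2 * (2 * R)) + Real.pi / (2 * t) := by
  have hint (n : ℕ) : Integrable fun ξ ↦ ‖𝓕 (iteratedDeriv n f) ξ‖ ^ 2 :=
    integrable_norm_sq_fourier_of_hasCompactSupport (hf.iteratedDeriv_infty n) (hc.iteratedDeriv n)
  have hle (n : ℕ) (hn : ∀ x, ‖iteratedDeriv n f x‖ ≤ M) :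
      ∫ ξ, ‖𝓕 (iteratedDeriv n f) ξ‖ ^ 2 ≤ M ^ 2 * (2 * R) := by
    rw [integral_norm_sq_fourier_of_hasCompactSupport (hf.iteratedDeriv_infty n)
      (hc.iteratedDeriv n)]
    exact integral_norm_sq_le_of_eq_zero_of_lt_abs hR
      (fun x ↦ iteratedDeriv_eq_zero_of_lt_abs hfR n) hn
  have hdom : Integrable fun ξ : ℝ ↦ t / 2 * (‖𝓕 (iteratedDeriv p f) ξ‖ ^ 2 +
      ‖𝓕 (iteratedDeriv (p + 1) f) ξ‖ ^ 2) + 1 / (2 * t) * (1 + ξ ^ 2)⁻¹ :=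
    (((hint p).add (hint (p + 1))).const_mul _).add (integrable_inv_one_add_sq.const_mul _)
  have hpt (ξ : ℝ) : ‖𝓕 f ξ‖ * |2 * Real.pi * ξ| ^ p ≤
      t / 2 * (‖𝓕 (iteratedDeriv p f) ξ‖ ^ 2 +
      ‖𝓕 (iteratedDeriv (p + 1) f) ξ‖ ^ 2) + 1 / (2 * t) * (1 + ξ ^ 2)⁻¹ := by
    rw [norm_fourier_iteratedDeriv hf hc, norm_fourier_iteratedDeriv hf hc, mul_comm]
    set u := 2 * Real.pi * ξ with hu
    set a := |u| ^ p * ‖𝓕 f ξ‖ with ha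
    have hu' : (|u| ^ (p + 1) * ‖𝓕 f ξ‖) ^ 2 = a ^ 2 * u ^ 2 := by
      rw [ha, ← sq_abs u]; ring
    have h1 : (1 + u ^ 2)⁻¹ ≤ (1 + ξ ^ 2)⁻¹ := by
      have : 1 ≤ (2 * Real.pi) ^ 2 := by nlinarith [Real.pi_gt_three]
      have : ξ ^ 2 ≤ u ^ 2 := by
        rw [hu, mul_pow]
        exact le_mul_of_one_le_left (sq_nonneg ξ) this
      gcongr ?_⁻¹
      linarith
    have h2 : a ≤ t / 2 * (a ^ 2 * (1 + u ^ 2)) + 1 / (2 * t) * (1 + u ^ 2)⁻¹ := by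
      have h3 : 0 < 1 + u ^ 2 := by positivity
      have h4 : 0 ≤ (t * a * (1 + u ^ 2) - 1) ^ 2 / (2 * t * (1 + u ^ 2)) := by positivity
      have h5 : (t * a * (1 + u ^ 2) - 1) ^ 2 / (2 * t * (1 + u ^ 2)) =
          t / 2 * (a ^ 2 * (1 + u ^ 2)) + 1 / (2 * t) * (1 + u ^ 2)⁻¹ - a := by
        field_simp
        ring
      linarith
    rw [hu']
    calc a ≤ _ := h2
      _ ≤ t / 2 * (a ^ 2 * (1 + u ^ 2)) + 1 / (2 * t) * (1 + ξ ^ 2)⁻¹ := by gcongr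
      _ = _ := by ring
  have hI : Integrable (fun ξ ↦ ‖𝓕 f ξ‖ * |2 * Real.pi * ξ| ^ p) := by
    refine hdom.mono' ?_ (.of_forall fun ξ ↦ ?_)
    · exact (integrable_fourier_of_hasCompactSupport hf hc).aestronglyMeasurable.norm.mul
        (by fun_prop)
    · rw [Real.norm_of_nonneg (by positivity)]
      exact hpt ξ
  refine ⟨hI, (integral_mono hI hdom hpt).trans ?_⟩
  rw [integral_add (f := fun ξ ↦ t / 2 * (‖𝓕 (iteratedDeriv p f) ξ‖ ^ 2 +
      ‖𝓕 (iteratedDeriv (p + 1) f) ξ‖ ^ 2)) (((hint p).add (hint (p + 1))).const_mul _)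
    (integrable_inv_one_add_sq.const_mul _), integral_const_mul, integral_const_mul,
    integral_add (hint p) (hint (p + 1)), integral_univ_inv_one_add_sq]
  have := hle p hp
  have := hle (p + 1) hp1
  calc _ ≤ t / 2 * (M ^ 2 * (2 * R) + M ^ 2 * (2 * R)) + 1 / (2 * t) * Real.pi := by gcongr
    _ = _ := by ring

lemma integral_eq_integral_fourier_mul_charFun {f : ℝ → ℂ} (hf : ContDiff ℝ ∞ f)
    (hc : HasCompactSupport f) (μ : Measure ℝ) [IsFiniteMeasure μ] :
    ∫ x, f x ∂μ = ∫ ξ, 𝓕 f ξ * charFun μ (2 * Real.pi * ξ) := by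
  have hFI := integrable_fourier_of_hasCompactSupport hf hc
  have hinv (x : ℝ) : f x = ∫ ξ : ℝ, 𝓕 f ξ * exp (↑(2 * Real.pi * ξ) * x * I) := by
    conv_lhs => rw [← hf.continuous.fourierInv_fourier_eq
      (hf.continuous.integrable_of_hasCompactSupport hc) hFI]
    rw [Real.fourierInv_eq']
    refine integral_congr_ae (.of_forall fun ξ ↦ ?_)
    simp only [smul_eq_mul, mul_comm (𝓕 f ξ)]
    congr 2
    simp
    ring
  simp_rw [charFun_apply_real, ← integral_const_mul]
  rw [integral_congr_ae (.of_forall hinv)]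
  refine integral_integral_swap (μ := μ) (ν := volume)
    (f := fun x ξ ↦ 𝓕 f ξ * exp (↑(2 * Real.pi * ξ) * x * I)) ?_
  have hFI' : Integrable (fun z : ℝ × ℝ ↦ 𝓕 f z.2) (μ.prod volume) := hFI.comp_snd μ
  refine hFI'.mono ?_ (.of_forall fun z ↦ ?_)
  · exact hFI'.aestronglyMeasurable.mul (Measurable.aestronglyMeasurable (by fun_prop))
  · rw [Function.uncurry_def, norm_mul, ← ofReal_mul, norm_exp_ofReal_mul_I, mul_one]

/-- The transfer estimate for smooth test functions supported in `[-R, R]`. -/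
lemma norm_integral_sub_integral_le_of_contDiff {f : ℝ → ℂ} (hf : ContDiff ℝ ∞ f) {p : ℕ}
    {R M t B : ℝ} (hR : 0 ≤ R) (ht : 0 < t) (hB : 0 ≤ B)
    (hfR : ∀ x, R < |x| → f x = 0) (hp : ∀ x, ‖iteratedDeriv p f x‖ ≤ M)
    (hp1 : ∀ x, ‖iteratedDeriv (p + 1) f x‖ ≤ M)
    (μ ν : Measure ℝ) [IsProbabilityMeasure μ] [IsProbabilityMeasure ν]
    (hμν : ∀ ξ, ‖charFun μ ξ - charFun ν ξ‖ ≤ B * |ξ| ^ p) :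
    ‖∫ x, f x ∂μ - ∫ x, f x ∂ν‖ ≤ B * (t * (M ^ 2 * (2 * R)) + Real.pi / (2 * t)) := by
  have hc : HasCompactSupport f := .of_eq_zero_of_lt_abs hfR
  have hFI := integrable_fourier_of_hasCompactSupport hf hc
  have hI (μ : Measure ℝ) [IsProbabilityMeasure μ] :
      Integrable fun ξ ↦ 𝓕 f ξ * charFun μ (2 * Real.pi * ξ) :=
    hFI.mul_bdd (c := 1) ((measurable_charFun.comp (by fun_prop)).aestronglyMeasurable)
      (.of_forall fun ξ ↦ norm_charFun_le_one _)
  obtain ⟨hJ, hle⟩ := integral_norm_fourier_mul_le hf hc hR ht hfR hp hp1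
  rw [integral_eq_integral_fourier_mul_charFun hf hc, integral_eq_integral_fourier_mul_charFun hf hc,
    ← integral_sub (hI μ) (hI ν)]
  calc _ ≤ ∫ ξ, B * (‖𝓕 f ξ‖ * |2 * Real.pi * ξ| ^ p) := by
        refine norm_integral_le_of_norm_le (hJ.const_mul B) (.of_forall fun ξ ↦ ?_)
        rw [← mul_sub, norm_mul, mul_left_comm]
        gcongr
        exact hμν _
    _ ≤ _ := by
        rw [integral_const_mul]
        gcongr

lemma iteratedDeriv_convolution_right {φ : ℝ → ℝ} (hφ : LocallyIntegrable φ) {f : ℝ → ℂ}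
    (hc : HasCompactSupport f) {n : ℕ} (hf : ContDiff ℝ n f) {k : ℕ} (hk : k ≤ n) :
    iteratedDeriv k (φ ⋆[ContinuousLinearMap.lsmul ℝ ℝ, volume] f) =
      φ ⋆[ContinuousLinearMap.lsmul ℝ ℝ, volume] iteratedDeriv k f := by
  induction k with
  | zero => simp
  | succ k ih =>
    rw [iteratedDeriv_succ, ih (by lia), iteratedDeriv_succ]
    ext x
    refine ((hc.iteratedDeriv k).hasDerivAt_convolution_right _ hφ ?_ x).deriv
    rw [iteratedDeriv_eq_iterate]
    exact ContDiff.iterate_deriv' 1 k (hf.of_le (by norm_cast; lia))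

lemma exists_contDiff_infty_approx {f : ℝ → ℂ} {n : ℕ} (hf : ContDiff ℝ n f) {R M η : ℝ}
    (hη : 0 < η) (hfR : ∀ x, R < |x| → f x = 0) (hM : ∀ k ≤ n, ∀ x, ‖iteratedDeriv k f x‖ ≤ M) :
    ∃ g : ℝ → ℂ, ContDiff ℝ ∞ g ∧ (∀ x, R + 1 < |x| → g x = 0) ∧
      (∀ k ≤ n, ∀ x, ‖iteratedDeriv k g x‖ ≤ M) ∧ ∀ x, ‖f x - g x‖ ≤ η := by
  have hc : HasCompactSupport f := .of_eq_zero_of_lt_abs hfR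
  obtain ⟨δ, hδ, hfδ⟩ := Metric.uniformContinuous_iff.mp
    (hc.uniformContinuous_of_continuous hf.continuous) η hη
  have hr : 0 < min δ 1 := lt_min hδ one_pos
  let φ : ContDiffBump (0 : ℝ) := ⟨min δ 1 / 2, min δ 1, half_pos hr, half_lt_self hr⟩
  have hφs : Function.support (φ.normed volume) ⊆ Metric.ball 0 (min δ 1) :=
    (φ.support_normed_eq (μ := volume)).subset
  have hφi : LocallyIntegrable (φ.normed volume) := φ.continuous_normed.locallyIntegrable
  have hdist {u : ℝ → ℂ} (hu : Continuous u) {x : ℝ} {z : ℂ} {a : ℝ} (ha : 0 ≤ a)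
      (h : ∀ y ∈ Metric.ball x (min δ 1), dist (u y) z ≤ a) :
      dist ((φ.normed volume ⋆[ContinuousLinearMap.lsmul ℝ ℝ, volume] u) x) z ≤ a :=
    dist_convolution_le ha hφs φ.nonneg_normed φ.integral_normed hu.aestronglyMeasurable h
  refine ⟨φ.normed volume ⋆[ContinuousLinearMap.lsmul ℝ ℝ, volume] f,
    φ.hasCompactSupport_normed.contDiff_convolution_left _ φ.contDiff_normed
      hf.continuous.locallyIntegrable, fun x hx ↦ ?_, fun k hk x ↦ ?_, fun x ↦ ?_⟩
  · refine dist_le_zero.mp (hdist hf.continuous le_rfl fun y hy ↦ ?_)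
    have h1 : |y - x| < 1 := (Real.dist_eq y x ▸ Metric.mem_ball.mp hy).trans_le (min_le_right _ _)
    have h2 : |x| ≤ |y| + |y - x| := by
      simpa [abs_sub_comm] using abs_add_le y (x - y)
    simp [hfR y (by linarith)]
  · rw [iteratedDeriv_convolution_right hφi hc hf hk, ← dist_zero_right]
    refine hdist (hf.continuous_iteratedDeriv k (mod_cast hk)) ((norm_nonneg _).trans (hM k hk 0))
      fun y _ ↦ ?_
    simpa using hM k hk y
  · rw [← dist_eq_norm, dist_comm]
    exact hdist hf.continuous hη.le fun y hy ↦
      (hfδ ((Metric.mem_ball.mp hy).trans_le (min_le_left _ _))).le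

lemma norm_iteratedDeriv_mul_le {f g : ℝ → ℝ} {n : ℕ} (hf : ContDiff ℝ n f) (hg : ContDiff ℝ n g)
    {M N : ℝ} (hM : ∀ k ≤ n, ∀ x, ‖iteratedDeriv k f x‖ ≤ M)
    (hN : ∀ k ≤ n, ∀ x, ‖iteratedDeriv k g x‖ ≤ N) {k : ℕ} (hk : k ≤ n) (x : ℝ) :
    ‖iteratedDeriv k (fun y ↦ f y * g y) x‖ ≤ 2 ^ n * (M * N) := by
  have hM0 : 0 ≤ M := (norm_nonneg _).trans (hM 0 n.zero_le 0)
  have hN0 : 0 ≤ N := (norm_nonneg _).trans (hN 0 n.zero_le 0)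
  rw [← norm_iteratedFDeriv_eq_norm_iteratedDeriv]
  refine (norm_iteratedFDeriv_mul_le hf hg x (mod_cast hk)).trans ?_
  calc _ ≤ ∑ i ∈ Finset.range (k + 1), (k.choose i : ℝ) * (M * N) := by
        refine Finset.sum_le_sum fun i hi ↦ ?_
        rw [norm_iteratedFDeriv_eq_norm_iteratedDeriv, norm_iteratedFDeriv_eq_norm_iteratedDeriv,
          mul_assoc]
        have := Finset.mem_range.mp hi
        gcongr
        · exact hM i (by lia) x
        · exact hN (k - i) (by lia) x
    _ = 2 ^ k * (M * N) := by
        rw [← Finset.sum_mul, ← Nat.cast_sum, Nat.sum_range_choose]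
        simp
    _ ≤ 2 ^ n * (M * N) := by
        gcongr
        norm_num

lemma exists_norm_iteratedDeriv_smoothTransition_le (n : ℕ) :
    ∃ S : ℝ, ∀ k ≤ n, ∀ x, ‖iteratedDeriv k Real.smoothTransition x‖ ≤ S := by
  have h (k : ℕ) : ∃ c, ∀ x, ‖iteratedDeriv k Real.smoothTransition x‖ ≤ c := by
    rcases k.eq_zero_or_pos with rfl | hk
    · refine ⟨1, fun x ↦ ?_⟩
      rw [iteratedDeriv_zero, Real.norm_of_nonneg (Real.smoothTransition.nonneg x)]
      exact Real.smoothTransition.le_one x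
    · refine Continuous.bounded_above_of_compact_support
        (Real.smoothTransition.contDiff.continuous_iteratedDeriv k le_rfl)
        (HasCompactSupport.intro (isCompact_Icc (a := 0) (b := 1)) fun x hx ↦ ?_)
      have : ∃ c, Real.smoothTransition =ᶠ[nhds x] fun _ ↦ c := by
        rcases lt_or_ge x 0 with hx0 | hx0
        · refine ⟨0, ?_⟩
          filter_upwards [gt_mem_nhds hx0] with y hy
          exact Real.smoothTransition.zero_of_nonpos hy.le
        · refine ⟨1, ?_⟩
          filter_upwards [lt_mem_nhds (not_le.mp fun h ↦ hx ⟨hx0, h⟩)] with y hy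
          exact Real.smoothTransition.one_of_one_le hy.le
      obtain ⟨c, hc⟩ := this
      rw [hc.iteratedDeriv_eq k, iteratedDeriv_const, if_neg hk.ne']
  choose c hc using h
  refine ⟨∑ k ∈ Finset.range (n + 1), c k, fun k hk x ↦ (hc k x).trans ?_⟩
  exact Finset.single_le_sum (fun i _ ↦ (norm_nonneg _).trans (hc i 0))
    (Finset.mem_range.mpr (by lia))

/-- Smooth cutoffs of `[-A, A]` inside `[-(A + 1), A + 1]` have derivatives bounded
independently of `A`. -/
lemma exists_cutoff (n : ℕ) :
    ∃ S : ℝ, ∀ A : ℝ, ∃ χ : ℝ → ℝ, ContDiff ℝ n χ ∧ (∀ x, 0 ≤ χ x) ∧ (∀ x, χ x ≤ 1) ∧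
      (∀ x, |x| ≤ A → χ x = 1) ∧ (∀ x, A + 1 < |x| → χ x = 0) ∧
      ∀ k ≤ n, ∀ x, ‖iteratedDeriv k χ x‖ ≤ S := by
  obtain ⟨S, hS⟩ := exists_norm_iteratedDeriv_smoothTransition_le n
  refine ⟨2 ^ n * (S * S), fun A ↦ ⟨fun x ↦ Real.smoothTransition (A + 1 - x) *
    Real.smoothTransition (A + 1 + x), ?_, fun x ↦ ?_, fun x ↦ ?_, fun x hx ↦ ?_, fun x hx ↦ ?_,
    fun k hk x ↦ ?_⟩⟩
  · exact (Real.smoothTransition.contDiff.comp (by fun_prop)).mul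
      (Real.smoothTransition.contDiff.comp (by fun_prop))
  · exact mul_nonneg (Real.smoothTransition.nonneg _) (Real.smoothTransition.nonneg _)
  · exact mul_le_one₀ (Real.smoothTransition.le_one _) (Real.smoothTransition.nonneg _)
      (Real.smoothTransition.le_one _)
  · have := abs_le.mp hx
    dsimp only
    rw [Real.smoothTransition.one_of_one_le (by linarith),
      Real.smoothTransition.one_of_one_le (by linarith), one_mul]
  · dsimp only
    rcases lt_abs.mp hx with h | h
    · rw [Real.smoothTransition.zero_of_nonpos (by linarith), zero_mul]
    · rw [Real.smoothTransition.zero_of_nonpos (x := A + 1 + x) (by linarith), mul_zero]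
  · refine norm_iteratedDeriv_mul_le (Real.smoothTransition.contDiff.comp (by fun_prop))
      (Real.smoothTransition.contDiff.comp (by fun_prop)) (fun j hj y ↦ ?_) (fun j hj y ↦ ?_) hk x
    · have := hS j hj (A + 1 - y)
      rw [Function.comp_def, iteratedDeriv_comp_const_sub]
      simpa [norm_smul] using this
    · have := hS j hj (A + 1 + y)
      rw [Function.comp_def, iteratedDeriv_comp_const_add]
      exact this

lemma norm_iteratedDeriv_ofReal_comp {f : ℝ → ℝ} {n : ℕ} (hf : ContDiff ℝ n f) {k : ℕ}
    (hk : k ≤ n) (x : ℝ) :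
    ‖iteratedDeriv k (fun y ↦ (f y : ℂ)) x‖ = ‖iteratedDeriv k f x‖ := by
  rw [← norm_iteratedFDeriv_eq_norm_iteratedDeriv, ← norm_iteratedFDeriv_eq_norm_iteratedDeriv]
  exact Complex.ofRealLI.norm_iteratedFDeriv_comp_left hf.contDiffAt (mod_cast hk)

/-- The transfer estimate in terms of the tail probabilities at level `A`. -/
lemma exists_abs_integral_sub_integral_le (p : ℕ) :
    ∃ K > (0 : ℝ), ∀ (μ ν : Measure ℝ) [IsProbabilityMeasure μ] [IsProbabilityMeasure ν]
      (A B : ℝ), 0 ≤ A → 0 ≤ B → (∀ ξ, ‖charFun μ ξ - charFun ν ξ‖ ≤ B * |ξ| ^ p) →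
      ∀ h : ℝ → ℝ, ContDiff ℝ (p + 1 : ℕ) h →
        (∀ k ≤ p + 1, ∀ x, ‖iteratedDeriv k h x‖ ≤ 1) →
        |∫ x, h x ∂μ - ∫ x, h x ∂ν| ≤
          μ.real {x | A < |x|} + ν.real {x | A < |x|} + B * (K * √(1 + A)) := by
  obtain ⟨S, hS⟩ := exists_cutoff (p + 1)
  set M := 2 ^ (p + 1) * (1 * S)
  refine ⟨M ^ 2 * 4 + Real.pi / 2, by positivity,
    fun μ ν _ _ A B hA hB hμν h hh hh1 ↦ ?_⟩
  obtain ⟨χ, hχ, hχ0, hχ1, hχA, hχA', hχS⟩ := hS A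
  have hgc : ContDiff ℝ (p + 1 : ℕ) fun x ↦ h x * χ x := hh.mul hχ
  have hh0 (x : ℝ) : |h x| ≤ 1 := by simpa using hh1 0 (by lia) x
  have hgb (x : ℝ) : |h x * χ x| ≤ 1 := by
    rw [abs_mul, abs_of_nonneg (hχ0 x)]
    exact mul_le_one₀ (hh0 x) (hχ0 x) (hχ1 x)
  have hgi (μ : Measure ℝ) [IsProbabilityMeasure μ] : Integrable (fun x ↦ h x * χ x) μ :=
    .of_bound hgc.continuous.aestronglyMeasurable 1 (.of_forall hgb)
  have htail (μ : Measure ℝ) [IsProbabilityMeasure μ] :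
      |∫ x, h x ∂μ - ∫ x, h x * χ x ∂μ| ≤ μ.real {x | A < |x|} := by
    have hhi : Integrable h μ :=
      .of_bound hh.continuous.aestronglyMeasurable 1 (.of_forall hh0)
    have hms : MeasurableSet {x : ℝ | A < |x|} := measurableSet_lt measurable_const measurable_abs
    rw [← integral_sub hhi (hgi μ), ← integral_indicator_one hms, ← Real.norm_eq_abs]
    refine norm_integral_le_of_norm_le ((integrable_const 1).indicator hms)
      (.of_forall fun x ↦ ?_)
    by_cases hx : A < |x|
    · rw [Set.indicator_of_mem (by exact hx), ← mul_one_sub, norm_mul, Pi.one_apply,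
        Real.norm_of_nonneg (sub_nonneg.mpr (hχ1 x))]
      exact mul_le_one₀ (hh0 x) (sub_nonneg.mpr (hχ1 x)) (sub_le_self _ (hχ0 x))
    · rw [Set.indicator_of_notMem (by exact hx), hχA x (not_lt.mp hx)]
      simp
  have hmain : |∫ x, h x * χ x ∂μ - ∫ x, h x * χ x ∂ν| ≤
      B * ((M ^ 2 * 4 + Real.pi / 2) * √(1 + A)) := by
    refine le_of_forall_pos_le_add fun η hη ↦ ?_
    obtain ⟨g, hg, hgA, hgM, hgη⟩ := exists_contDiff_infty_approx (n := p + 1)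
      (f := fun x ↦ ((h x * χ x : ℝ) : ℂ)) (R := A + 1) (M := M)
      (Complex.ofRealCLM.contDiff.comp hgc) (half_pos hη) (fun x hx ↦ by simp [hχA' x hx])
      (fun k hk x ↦ by
        rw [norm_iteratedDeriv_ofReal_comp hgc hk]
        exact norm_iteratedDeriv_mul_le hh hχ hh1 hχS hk x)
    have happ (μ : Measure ℝ) [IsProbabilityMeasure μ] :
        ‖((∫ x, h x * χ x ∂μ : ℝ) : ℂ) - ∫ x, g x ∂μ‖ ≤ η / 2 := by
      have hgI : Integrable g μ :=
        hg.continuous.integrable_of_hasCompactSupport (.of_eq_zero_of_lt_abs hgA)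
      have hfI : Integrable (fun x ↦ ((h x * χ x : ℝ) : ℂ)) μ := (hgi μ).ofReal
      rw [← integral_complex_ofReal, ← integral_sub hfI hgI]
      simpa using norm_integral_le_of_norm_le_const (μ := μ) (.of_forall hgη)
    have hs : 0 < √(1 + A) := Real.sqrt_pos.mpr (by linarith)
    have hsq : √(1 + A) ^ 2 = 1 + A := Real.sq_sqrt (by linarith)
    have hcore := norm_integral_sub_integral_le_of_contDiff hg (p := p) (R := A + 1 + 1)
      (t := (√(1 + A))⁻¹) (by linarith) (inv_pos.mpr hs) hB hgA (hgM p (by lia)) (hgM _ le_rfl)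
      μ ν hμν
    have hle : (√(1 + A))⁻¹ * (M ^ 2 * (2 * (A + 1 + 1))) + Real.pi / (2 * (√(1 + A))⁻¹) ≤
        (M ^ 2 * 4 + Real.pi / 2) * √(1 + A) := by
      have h1 : (√(1 + A))⁻¹ * (M ^ 2 * (2 * (A + 1 + 1))) ≤ M ^ 2 * 4 * √(1 + A) := by
        rw [inv_mul_le_iff₀ hs]
        nlinarith [mul_nonneg (sq_nonneg M) hA]
      have h2 : Real.pi / (2 * (√(1 + A))⁻¹) = Real.pi / 2 * √(1 + A) := by
        field_simp
      linarith
    have htri : ‖((∫ x, h x * χ x ∂μ : ℝ) : ℂ) - ((∫ x, h x * χ x ∂ν : ℝ) : ℂ)‖ ≤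
        ‖((∫ x, h x * χ x ∂μ : ℝ) : ℂ) - ∫ x, g x ∂μ‖ + ‖∫ x, g x ∂μ - ∫ x, g x ∂ν‖ +
          ‖((∫ x, h x * χ x ∂ν : ℝ) : ℂ) - ∫ x, g x ∂ν‖ := by
      rw [norm_sub_rev (((∫ x, h x * χ x ∂ν : ℝ) : ℂ))]
      refine le_trans (le_of_eq ?_) norm_add₃_le
      congr 1
      ring
    rw [← ofReal_sub, norm_real, Real.norm_eq_abs] at htri
    have := happ μ
    have := happ ν
    have := mul_le_mul_of_nonneg_left hle hB
    linarith
  have h1 := htail μ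
  have h2 := htail ν
  rw [abs_le] at h1 h2 hmain ⊢
  constructor <;> linarith [h1.1, h1.2, h2.1, h2.2, hmain.1, hmain.2]

end

/-- **Theorem 2.1 (transfer principle).** There is a constant `K = C_p > 0` depending
only on `p` such that for any real random variables `X, Y` whose characteristic
functions satisfy (H1) `|ψ(ξ) − φ(ξ)| ≤ C' ε |ξ|^p`, and which satisfy the
sub-exponential tail bound (H2), the smooth Wasserstein distance `W_{p+1}(X,Y)`
(formulated as a bound over all test functions `h ∈ C^{p+1}` with all derivatives of
order `0,…,p+1` bounded by `1`) is at most
`2ε [C + (2^{p−1} √10 C' K / π) √(1 + (λ⁻¹ log(1/ε))^{1/α})]`. -/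
theorem stein_tikhomirov_transfer_subexponential (p : ℕ) :
    ∃ K > (0 : ℝ),
      ∀ (Ω : Type) (_ : MeasureSpace Ω) (_ : IsProbabilityMeasure (ℙ : Measure Ω))
        (X Y : Ω → ℝ), Measurable X → Measurable Y →
        ∀ (C' ε C lam α : ℝ), 0 < C' → 0 < ε → ε < 1 → 0 < lam → 0 < C → 0 < α →
        -- (H1): pointwise bound on the difference of characteristic functions
        (∀ ξ : ℝ, ‖(∫ ω, Complex.exp (Complex.I * ξ * Y ω)) -
            (∫ ω, Complex.exp (Complex.I * ξ * X ω))‖ ≤ C' * ε * |ξ| ^ p) →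
        -- (H2): sub-exponential tails for X and Y
        (∀ A : ℝ, 0 < A →
          ℙ {ω | A < |X ω|} ≤ ENNReal.ofReal (C * Real.exp (-lam * A ^ α))) →
        (∀ A : ℝ, 0 < A →
          ℙ {ω | A < |Y ω|} ≤ ENNReal.ofReal (C * Real.exp (-lam * A ^ α))) →
        -- conclusion: W_{p+1}(X,Y) ≤ 2ε[C + (2^{p-1}√10 C' K/π)√(1+(λ⁻¹log(1/ε))^{1/α})]
        ∀ h : ℝ → ℝ, ContDiff ℝ (p + 1) h →
          (∀ k ≤ p + 1, ∀ x, |iteratedDeriv k h x| ≤ 1) →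
          |(∫ ω, h (X ω)) - (∫ ω, h (Y ω))| ≤
            2 * ε * (C + (2 ^ ((p : ℝ) - 1) * Real.sqrt 10 * C' * K / Real.pi) *
              Real.sqrt (1 + (lam⁻¹ * Real.log (1 / ε)) ^ ((1 : ℝ) / α))) := by
  obtain ⟨K, hK, hmain⟩ := exists_abs_integral_sub_integral_le p
  have hc : 0 < (2 : ℝ) ^ ((p : ℝ) - 1) * √10 / Real.pi := by positivity
  refine ⟨K / (2 * ((2 : ℝ) ^ ((p : ℝ) - 1) * √10 / Real.pi)), by positivity, ?_⟩
  intro Ω _ _ X Y hX hY C' ε C lam α hC' hε hε1 hlam hC hα hchar htX htY h hh hh1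
  have hlog : 0 < lam⁻¹ * Real.log (1 / ε) :=
    mul_pos (inv_pos.mpr hlam) (Real.log_pos ((one_lt_div hε).mpr hε1))
  set A := (lam⁻¹ * Real.log (1 / ε)) ^ ((1 : ℝ) / α) with hA
  have hA0 : 0 < A := Real.rpow_pos_of_pos hlog _
  have hexp : Real.exp (-lam * A ^ α) = ε := by
    rw [hA, ← Real.rpow_mul hlog.le, one_div_mul_cancel hα.ne', Real.rpow_one, neg_mul,
      mul_inv_cancel_left₀ hlam.ne', one_div, Real.log_inv, neg_neg, Real.exp_log hε]
  have htail {Z : Ω → ℝ} (hZ : Measurable Z)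
      (ht : ℙ {ω | A < |Z ω|} ≤ ENNReal.ofReal (C * Real.exp (-lam * A ^ α))) :
      (Measure.map Z ℙ).real {x | A < |x|} ≤ C * ε := by
    rw [map_measureReal_apply hZ (measurableSet_lt measurable_const measurable_abs)]
    rw [hexp] at ht
    exact ENNReal.toReal_le_of_le_ofReal (by positivity) ht
  have hcf {Z : Ω → ℝ} (hZ : Measurable Z) (ξ : ℝ) :
      charFun (Measure.map Z ℙ) ξ = ∫ ω, Complex.exp (Complex.I * ξ * Z ω) := by
    rw [charFun_apply_real, integral_map hZ.aemeasurable (by fun_prop)]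
    refine integral_congr_ae (.of_forall fun ω ↦ ?_)
    dsimp only
    congr 1
    ring
  have : IsProbabilityMeasure (Measure.map X ℙ) := Measure.isProbabilityMeasure_map hX.aemeasurable
  have : IsProbabilityMeasure (Measure.map Y ℙ) := Measure.isProbabilityMeasure_map hY.aemeasurable
  have hle := hmain (Measure.map X ℙ) (Measure.map Y ℙ) A (C' * ε) hA0.le (by positivity)
    (fun ξ ↦ by
      rw [hcf hX, hcf hY, norm_sub_rev]
      exact hchar ξ) h (by exact_mod_cast hh) hh1
  rw [integral_map hX.aemeasurable hh.continuous.aestronglyMeasurable,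
    integral_map hY.aemeasurable hh.continuous.aestronglyMeasurable] at hle
  have h1 := htail hX (htX A hA0)
  have h2 := htail hY (htY A hA0)
  calc _ ≤ C * ε + C * ε + C' * ε * (K * √(1 + A)) := hle.trans (by gcongr)
    _ = _ := by
      field_simp
      ring
end

section
/- Let X and Y be real random variables with characteristic functions φ and ψ respectively. Assume (H1): there exist p ∈ ℕ, C' > 0 and 0 < ε < 1 such that |ψ(ξ) − φ(ξ)| ≤ C' ε |ξ|^p for all ξ ∈ ℝ; and (H2'): there exist γ > 0 and C > 0 such that for all A > 0, P(|X| > A) ≤ C A^{−γ} and P(|Y| > A) ≤ C A^{−γ}. Then there exist a constant K > 0 depending only on p, γ, C and C', and a threshold ε₀ > 0 depending only on p, γ and C, such that if ε < ε₀ then W_{p+1}(X, Y) ≤ K ε^{2γ/(2γ+1)}. -/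
open MeasureTheory ProbabilityTheory Complex
open scoped FourierTransform SchwartzMap

theorem continuous_fourier_of_integrable {g : ℝ → ℂ} (hg : Integrable g) : Continuous (𝓕 g) :=
  VectorFourier.fourierIntegral_continuous Real.continuous_fourierChar
    (L := innerₗ ℝ) continuous_inner hg

open scoped ContDiff in
/-- The `L²` Fourier transform of a function in `L¹ ∩ L²` is given by the Fourier integral. -/
theorem fourier_toLp_ae_eq {g : ℝ → ℂ} (hg : Integrable g) (hg2 : MemLp g 2) :
    (𝓕 (hg2.toLp g) : Lp ℂ 2 (volume : Measure ℝ)) =ᵐ[volume] 𝓕 g := by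
  have hcont := continuous_fourier_of_integrable hg
  refine ae_eq_of_integral_contDiff_smul_eq
    ((Lp.memLp (𝓕 (hg2.toLp g) : Lp ℂ 2 (volume : Measure ℝ))).locallyIntegrable (by norm_num))
    hcont.locallyIntegrable fun φ hφ hφs => ?_
  have hφs' : HasCompactSupport (fun x => (φ x : ℂ)) := hφs.comp_left (g := Complex.ofReal) rfl
  have hφc : ContDiff ℝ ∞ (fun x => (φ x : ℂ)) := ofRealCLM.contDiff.comp hφ
  set Φ : 𝓢(ℝ, ℂ) := hφs'.toSchwartzMap hφc
  have hΦ (x : ℝ) : Φ x = φ x := rfl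
  have key := DFunLike.congr_fun (Lp.fourier_toTemperedDistribution_eq (hg2.toLp g)) Φ
  rw [TemperedDistribution.fourier_apply, Lp.toTemperedDistribution_apply,
    Lp.toTemperedDistribution_apply] at key
  have h1 : ∫ x, (𝓕 Φ) x • (hg2.toLp g) x = ∫ x, (𝓕 (Φ : ℝ → ℂ)) x • g x := by
    refine integral_congr_ae ?_
    filter_upwards [hg2.coeFn_toLp] with x hx
    rw [hx, SchwartzMap.fourier_coe]
  have h2 : ∫ x, (𝓕 (Φ : ℝ → ℂ)) x • g x = ∫ x, Φ x • 𝓕 g x := by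
    have := VectorFourier.integral_fourierIntegral_smul_eq_flip (L := innerₗ ℝ)
      (μ := volume) (ν := volume) Real.continuous_fourierChar continuous_inner
      Φ.integrable hg
    rw [flip_innerₗ] at this
    exact this
  rw [h1, h2] at key
  simpa [hΦ] using key.symm

/-- **Plancherel's identity** for Fourier integrals of functions in `L¹ ∩ L²`. -/
theorem integral_norm_sq_fourier_eq {g : ℝ → ℂ} (hg : Integrable g) (hg2 : MemLp g 2) :
    Integrable (fun ξ => ‖𝓕 g ξ‖ ^ 2) ∧ ∫ ξ, ‖𝓕 g ξ‖ ^ 2 = ∫ x, ‖g x‖ ^ 2 := by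
  have hae := fourier_toLp_ae_eq hg hg2
  have hmem : MemLp (𝓕 g) 2 :=
    (Lp.memLp (𝓕 (hg2.toLp g) : Lp ℂ 2 (volume : Measure ℝ))).ae_eq hae
  have hnorm : eLpNorm (𝓕 g) 2 = eLpNorm g 2 := by
    rw [← eLpNorm_congr_ae hae, ← Lp.enorm_def, ← Lp.enorm_toLp hg2, ← ofReal_norm,
      ← ofReal_norm, Lp.norm_fourier_eq]
  refine ⟨hmem.integrable_norm_pow two_ne_zero, ?_⟩
  have hsq {f : ℝ → ℂ} (hf : MemLp f 2) : ∫ x, ‖f x‖ ^ 2 = (eLpNorm f 2 ^ 2).toReal := by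
    rw [integral_eq_lintegral_of_nonneg_ae (f := fun x => ‖f x‖ ^ 2)
      (.of_forall fun x => by positivity) (hf.1.norm.pow 2)]
    have := eLpNorm_nnreal_pow_eq_lintegral (f := f) (μ := volume) (p := 2) two_ne_zero
    norm_cast at this
    simp at this
    simp [this, ENNReal.ofReal_pow]
  rw [hsq hmem, hsq hg2, hnorm]

/-- A compactly supported `C¹` function has an integrable Fourier transform, whose `L¹` norm is
controlled by the `H¹` norm of the function. -/
theorem integral_norm_fourier_le {g : ℝ → ℂ} (hg : ContDiff ℝ 1 g) (hs : HasCompactSupport g)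
    {B : ℝ} (hB : 0 < B) (hgB : (∫ x, ‖g x‖ ^ 2) + ∫ x, ‖deriv g x‖ ^ 2 ≤ B ^ 2) :
    Integrable (𝓕 g) ∧ ∫ ξ, ‖𝓕 g ξ‖ ≤ (1 + Real.pi) / 2 * B := by
  have hc' : Continuous (deriv g) := hg.continuous_deriv le_rfl
  have hi : Integrable g := hg.continuous.integrable_of_hasCompactSupport hs
  have hi' : Integrable (deriv g) := hc'.integrable_of_hasCompactSupport hs.deriv
  obtain ⟨h1, e1⟩ := integral_norm_sq_fourier_eq hi (hg.continuous.memLp_of_hasCompactSupport hs)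
  obtain ⟨h2, e2⟩ := integral_norm_sq_fourier_eq hi' (hc'.memLp_of_hasCompactSupport hs.deriv)
  have hcont := continuous_fourier_of_integrable hi
  have hd := Real.fourier_deriv hi (hg.differentiable one_ne_zero) hi'
  set F : ℝ → ℝ := fun ξ =>
    2⁻¹ * (B⁻¹ * (‖𝓕 g ξ‖ ^ 2 + ‖𝓕 (deriv g) ξ‖ ^ 2) + B * (1 + ξ ^ 2)⁻¹) with hF
  have hle (ξ : ℝ) : ‖𝓕 g ξ‖ ≤ F ξ := by
    have e : ‖𝓕 (deriv g) ξ‖ ^ 2 = (2 * Real.pi) ^ 2 * ξ ^ 2 * ‖𝓕 g ξ‖ ^ 2 := by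
      rw [hd]
      simp only [smul_eq_mul, norm_mul, norm_real, norm_I, Real.norm_eq_abs, mul_pow, sq_abs,
        Complex.norm_ofNat]
      ring
    have hpi : 1 ≤ (2 * Real.pi) ^ 2 := by nlinarith [Real.pi_gt_three]
    have h3 : (1 + ξ ^ 2) * ‖𝓕 g ξ‖ ^ 2 ≤ ‖𝓕 g ξ‖ ^ 2 + ‖𝓕 (deriv g) ξ‖ ^ 2 := by
      rw [e]
      have : 0 ≤ ξ ^ 2 * ‖𝓕 g ξ‖ ^ 2 := by positivity
      nlinarith
    have hpos : 0 < 1 + ξ ^ 2 := by positivity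
    calc ‖𝓕 g ξ‖ ≤ 2⁻¹ * (B⁻¹ * ((1 + ξ ^ 2) * ‖𝓕 g ξ‖ ^ 2) + B * (1 + ξ ^ 2)⁻¹) := by
          rw [← sub_nonneg]
          have : 2⁻¹ * (B⁻¹ * ((1 + ξ ^ 2) * ‖𝓕 g ξ‖ ^ 2) + B * (1 + ξ ^ 2)⁻¹) - ‖𝓕 g ξ‖ =
              ((1 + ξ ^ 2) * ‖𝓕 g ξ‖ - B) ^ 2 / (2 * B * (1 + ξ ^ 2)) := by
            field_simp
            ring
          rw [this]
          positivity
      _ ≤ F ξ := by simp only [hF]; gcongr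
  have hFint : Integrable F :=
    (((h1.add h2).const_mul _).add (integrable_inv_one_add_sq.const_mul _)).const_mul _
  refine ⟨hFint.mono' hcont.aestronglyMeasurable (.of_forall hle), ?_⟩
  calc ∫ ξ, ‖𝓕 g ξ‖ ≤ ∫ ξ, F ξ :=
        integral_mono_of_nonneg (.of_forall fun _ => norm_nonneg _) hFint (.of_forall hle)
    _ = 2⁻¹ * (B⁻¹ * ((∫ x, ‖g x‖ ^ 2) + ∫ x, ‖deriv g x‖ ^ 2) + B * Real.pi) := by
        simp only [hF]
        have h12 : Integrable fun ξ => ‖𝓕 g ξ‖ ^ 2 + ‖𝓕 (deriv g) ξ‖ ^ 2 := h1.add h2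
        rw [integral_const_mul, integral_add (h12.const_mul _)
          (integrable_inv_one_add_sq.const_mul _), integral_const_mul, integral_const_mul,
          integral_add h1 h2, e1, e2, integral_univ_inv_one_add_sq]
    _ ≤ 2⁻¹ * (B⁻¹ * B ^ 2 + B * Real.pi) := by gcongr
    _ = (1 + Real.pi) / 2 * B := by field_simp

/-- Fourier inversion under the integral sign expresses expectations through the characteristic
function. -/
theorem integral_eq_integral_charFun_mul_fourier (μ : Measure ℝ) [IsProbabilityMeasure μ]
    {f : ℝ → ℂ} (hc : Continuous f) (hf : Integrable f) (hf' : Integrable (𝓕 f)) :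
    ∫ x, f x ∂μ = ∫ ξ, charFun μ (2 * Real.pi * ξ) * 𝓕 f ξ := by
  have hcont := continuous_fourier_of_integrable hf
  have hinv (x : ℝ) : f x = ∫ ξ : ℝ, Complex.exp (2 * Real.pi * ξ * x * I) * 𝓕 f ξ := by
    rw [← congrFun (hc.fourierInv_fourier_eq hf hf') x, Real.fourierInv_eq']
    congr! with ξ
    simp
    ring
  simp_rw [charFun_apply_real, ← integral_mul_const]
  rw [integral_integral_swap]
  · congr! with x
    rw [hinv]
    congr! with ξ
    push_cast
    ring
  · have h1 : Integrable (fun z : ℝ × ℝ => 𝓕 f z.1) (volume.prod μ) := hf'.comp_fst μ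
    refine h1.mono (by fun_prop) (.of_forall fun z => ?_)
    rw [Function.uncurry_def, norm_mul, norm_exp]
    simp

/-- Smooth truncation to `[-A, A]` preserves bounds on derivatives up to a constant that does not
depend on the scale `A ≥ 1`. -/
theorem exists_truncation (n : ℕ) : ∃ M > (0 : ℝ), ∀ A : ℝ, 1 ≤ A → ∀ h : ℝ → ℝ,
    ContDiff ℝ n h → (∀ k ≤ n, ∀ x, |iteratedDeriv k h x| ≤ 1) →
    ∃ f : ℝ → ℝ, ContDiff ℝ n f ∧ tsupport f ⊆ Set.Icc (-(2 * A)) (2 * A) ∧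
      (∀ k ≤ n, ∀ x, |iteratedDeriv k f x| ≤ M) ∧ (∀ x, |x| ≤ A → f x = h x) ∧
      ∀ x, |h x - f x| ≤ 1 := by
  let χ : ContDiffBump (0 : ℝ) := ⟨1, 2, one_pos, one_lt_two⟩
  have hχ : ContDiff ℝ n χ := χ.contDiff
  have hbd (k : ℕ) (hk : k ≤ n) : ∃ b, ∀ x, ‖iteratedDeriv k χ x‖ ≤ b := by
    have hc := hχ.continuous_iteratedDeriv k (by exact_mod_cast hk)
    refine hc.bounded_above_of_compact_support ?_
    rw [iteratedDeriv_eq_equiv_comp]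
    exact (χ.hasCompactSupport.iteratedFDeriv k).comp_left (by simp)
  choose! b hb using hbd
  have hb0 (k : ℕ) (hk : k ≤ n) : 0 ≤ b k := (norm_nonneg _).trans (hb k hk 0)
  have hS : 0 ≤ ∑ j ∈ Finset.range (n + 1), b j :=
    Finset.sum_nonneg fun j hj => hb0 j (by grind)
  refine ⟨2 ^ n * ∑ j ∈ Finset.range (n + 1), b j + 1, by positivity, fun A hA h hh hh1 => ?_⟩
  have hA0 : 0 < A := one_pos.trans_le hA
  have hχA : ContDiff ℝ n fun x => χ (A⁻¹ * x) := hχ.comp (by fun_prop)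
  refine ⟨h * fun x => χ (A⁻¹ * x), hh.mul hχA, ?_, fun k hk x => ?_, fun x hx => ?_, fun x => ?_⟩
  · refine closure_minimal (fun x hx => ?_) isClosed_Icc
    have : χ (A⁻¹ * x) ≠ 0 := right_ne_zero_of_mul hx
    have : A⁻¹ * x ∈ Function.support χ := this
    rw [χ.support_eq, mem_ball_zero_iff, Real.norm_eq_abs, abs_mul, abs_of_pos (inv_pos.2 hA0),
      inv_mul_lt_iff₀ hA0] at this
    exact abs_le.1 (by linarith [show χ.rOut = 2 from rfl])
  · have hk' : (k : WithTop ℕ∞) ≤ n := by exact_mod_cast hk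
    rw [iteratedDeriv_mul (hh.of_le hk').contDiffAt (hχA.of_le hk').contDiffAt]
    have hterm (j : ℕ) (hj : j ∈ Finset.range (k + 1)) :
        |(k.choose j : ℝ) * iteratedDeriv j h x * iteratedDeriv (k - j) (fun x => χ (A⁻¹ * x)) x|
          ≤ k.choose j * ∑ j ∈ Finset.range (n + 1), b j := by
      have hkj : k - j ≤ n := by omega
      have h1 : |iteratedDeriv (k - j) (fun x => χ (A⁻¹ * x)) x| ≤
          ∑ j ∈ Finset.range (n + 1), b j := by
        rw [iteratedDeriv_comp_const_mul (hχ.of_le (by exact_mod_cast hkj)), abs_mul, abs_pow,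
          abs_of_pos (inv_pos.2 hA0)]
        calc A⁻¹ ^ (k - j) * |iteratedDeriv (k - j) χ (A⁻¹ * x)| ≤ 1 * b (k - j) := by
              gcongr
              · exact pow_le_one₀ (by positivity) (inv_le_one_of_one_le₀ hA)
              · exact hb _ hkj _
          _ ≤ ∑ j ∈ Finset.range (n + 1), b j := by
              rw [one_mul]
              exact Finset.single_le_sum (fun i hi => hb0 i (by grind)) (by grind)
      rw [abs_mul, abs_mul, Nat.abs_cast, mul_assoc]
      gcongr
      calc _ ≤ 1 * ∑ j ∈ Finset.range (n + 1), b j := by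
            gcongr
            exact hh1 j (by grind) x
        _ = _ := one_mul _
    calc _ ≤ ∑ j ∈ Finset.range (k + 1), (k.choose j : ℝ) * ∑ j ∈ Finset.range (n + 1), b j :=
          (Finset.abs_sum_le_sum_abs _ _).trans (Finset.sum_le_sum hterm)
      _ = 2 ^ k * ∑ j ∈ Finset.range (n + 1), b j := by
          rw [← Finset.sum_mul]
          exact_mod_cast congrArg (fun m : ℕ => (m : ℝ) * _) (Nat.sum_range_choose k)
      _ ≤ 2 ^ n * ∑ j ∈ Finset.range (n + 1), b j := by
          gcongr
          exact one_le_two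
      _ ≤ _ := by linarith
  · have : χ (A⁻¹ * x) = 1 := by
      apply χ.one_of_mem_closedBall
      rw [mem_closedBall_zero_iff, Real.norm_eq_abs, abs_mul, abs_of_pos (inv_pos.2 hA0),
        inv_mul_le_iff₀ hA0]
      linarith [show χ.rIn = 1 from rfl]
    simp [this]
  · have h1 : |h x| ≤ 1 := by simpa using hh1 0 n.zero_le x
    have h2 : h x - (h * fun x => χ (A⁻¹ * x)) x = h x * (1 - χ (A⁻¹ * x)) := by
      simp only [Pi.mul_apply]; ring
    rw [h2, abs_mul]
    refine mul_le_one₀ h1 (abs_nonneg _) ?_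
    rw [abs_le]
    constructor <;> linarith [χ.nonneg (x := A⁻¹ * x), χ.le_one (x := A⁻¹ * x)]

/-- Changing a test function by at most one outside `[-A, A]` costs at most the tail mass. -/
theorem abs_integral_sub_le_of_eqOn {μ : Measure ℝ} [IsProbabilityMeasure μ] {h f : ℝ → ℝ}
    (hh : Integrable h μ) (hf : Integrable f μ) {A t : ℝ} (ht : 0 ≤ t)
    (heq : ∀ x, |x| ≤ A → f x = h x) (hle : ∀ x, |h x - f x| ≤ 1)
    (hμ : μ {x | A < |x|} ≤ ENNReal.ofReal t) : |(∫ x, h x ∂μ) - ∫ x, f x ∂μ| ≤ t := by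
  have hmeas : MeasurableSet {x : ℝ | A < |x|} := measurableSet_lt measurable_const (by fun_prop)
  have hzero : ∀ x ∉ {x : ℝ | A < |x|}, h x - f x = 0 := fun x hx => by
    rw [heq x (not_lt.1 hx), sub_self]
  rw [← integral_sub hh hf, ← setIntegral_eq_integral_of_forall_compl_eq_zero hzero]
  rw [← Real.norm_eq_abs]
  calc _ ≤ 1 * μ.real {x | A < |x|} :=
        norm_setIntegral_le_of_norm_le_const (measure_lt_top _ _) fun x _ => hle x
    _ ≤ t := by
        rw [one_mul]
        exact ENNReal.toReal_le_of_le_ofReal ht hμ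

theorem integral_norm_sq_le_of_support_subset {u : ℝ → ℂ} {A M : ℝ} (hA : 0 ≤ A)
    (hs : Function.support u ⊆ Set.Icc (-(2 * A)) (2 * A)) (hM : ∀ x, ‖u x‖ ≤ M) :
    ∫ x, ‖u x‖ ^ 2 ≤ M ^ 2 * (4 * A) := by
  have hzero : ∀ x ∉ Set.Icc (-(2 * A)) (2 * A), ‖u x‖ ^ 2 = 0 := fun x hx => by
    rw [Function.notMem_support.1 fun h => hx (hs h)]
    simp
  rw [← setIntegral_eq_integral_of_forall_compl_eq_zero hzero]
  calc _ ≤ ‖∫ x in Set.Icc (-(2 * A)) (2 * A), ‖u x‖ ^ 2‖ := le_abs_self _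
    _ ≤ M ^ 2 * volume.real (Set.Icc (-(2 * A)) (2 * A)) := by
        refine norm_setIntegral_le_of_norm_le_const measure_Icc_lt_top fun x _ => ?_
        rw [norm_pow, norm_norm]
        gcongr
        exact hM x
    _ = M ^ 2 * (4 * A) := by
        rw [Real.volume_real_Icc_of_le (by linarith)]
        ring

/-- Closeness of characteristic functions controls the difference of expectations of compactly
supported test functions, at a cost of the square root of the size of the support. -/
theorem abs_integral_sub_integral_le_of_charFun {μ ν : Measure ℝ} [IsProbabilityMeasure μ]
    [IsProbabilityMeasure ν] {p : ℕ} {δ A M : ℝ} (hA : 0 < A) (hM : 0 < M)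
    (hδ : ∀ ξ, ‖charFun μ ξ - charFun ν ξ‖ ≤ δ * |ξ| ^ p) {f : ℝ → ℝ}
    (hf : ContDiff ℝ (p + 1 : ℕ) f) (hs : tsupport f ⊆ Set.Icc (-(2 * A)) (2 * A))
    (hfM : ∀ k ≤ p + 1, ∀ x, |iteratedDeriv k f x| ≤ M) :
    |(∫ x, f x ∂μ) - ∫ x, f x ∂ν| ≤ δ * ((1 + Real.pi) / 2 * (M * √(8 * A))) := by
  have hδ0 : 0 ≤ δ := by simpa using (norm_nonneg _).trans (hδ 1)
  set F : ℝ → ℂ := fun x => (f x : ℂ) with hFdef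
  have hF : ContDiff ℝ (p + 1 : ℕ) F := ofRealCLM.contDiff.comp hf
  have hFs : tsupport F ⊆ Set.Icc (-(2 * A)) (2 * A) := by
    refine (closure_mono fun x hx => ?_).trans hs
    simpa [hFdef] using hx
  have hFM (k : ℕ) (hk : k ≤ p + 1) (x : ℝ) : ‖iteratedDeriv k F x‖ ≤ M := by
    rw [← norm_iteratedFDeriv_eq_norm_iteratedDeriv]
    have := ofRealLI.norm_iteratedFDeriv_comp_left (f := f) (x := x) (i := k)
      hf.contDiffAt (by exact_mod_cast hk)
    refine (this.trans ?_).trans_le (hfM k hk x)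
    rw [norm_iteratedFDeriv_eq_norm_iteratedDeriv, Real.norm_eq_abs]
  have hsupp (k : ℕ) : Function.support (iteratedDeriv k F) ⊆ tsupport F := by
    refine fun x hx => support_iteratedFDeriv_subset (𝕜 := ℝ) k ?_
    rw [Function.mem_support, ← norm_ne_zero_iff, norm_iteratedFDeriv_eq_norm_iteratedDeriv]
    exact norm_ne_zero_iff.2 hx
  have hcomp (k : ℕ) : HasCompactSupport (iteratedDeriv k F) :=
    isCompact_Icc.of_isClosed_subset (isClosed_tsupport _)
      (closure_minimal ((hsupp k).trans hFs) isClosed_Icc)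
  have hint (k : ℕ) (hk : (k : ℕ∞) ≤ (p + 1 : ℕ)) : Integrable (iteratedDeriv k F) :=
    (hF.continuous_iteratedDeriv k (by exact_mod_cast hk)).integrable_of_hasCompactSupport
      (hcomp k)
  have hC1 (k : ℕ) (hk : k ≤ p) : ContDiff ℝ 1 (iteratedDeriv k F) := by
    rw [iteratedDeriv_eq_iterate]
    exact ContDiff.iterate_deriv' 1 k (hF.of_le (by exact_mod_cast (by omega : 1 + k ≤ p + 1)))
  have hFc : HasCompactSupport F := by simpa using hcomp 0
  have hFi : Integrable F := by simpa using hint 0 (by simp)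
  have hFint : Integrable (𝓕 F) := by
    have h0 : 0 ≤ (∫ x, ‖F x‖ ^ 2) + ∫ x, ‖deriv F x‖ ^ 2 := by positivity
    exact (integral_norm_fourier_le (by simpa using hC1 0 p.zero_le) hFc
      (B := (∫ x, ‖F x‖ ^ 2) + (∫ x, ‖deriv F x‖ ^ 2) + 1) (by positivity) (by nlinarith)).1
  obtain ⟨hgi, hgB⟩ := integral_norm_fourier_le (hC1 p le_rfl) (hcomp p)
    (B := M * √(8 * A)) (by positivity) (by
      have h1 := integral_norm_sq_le_of_support_subset hA.le ((hsupp p).trans hFs)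
        (hFM p p.le_succ)
      have h2 := integral_norm_sq_le_of_support_subset hA.le ((hsupp (p + 1)).trans hFs)
        (hFM (p + 1) le_rfl)
      rw [iteratedDeriv_succ] at h2
      rw [mul_pow, Real.sq_sqrt (by positivity)]
      linarith)
  have hfour := Real.fourier_iteratedDeriv (N := (p + 1 : ℕ)) (by exact_mod_cast hF) hint
    (n := p) (by exact_mod_cast p.le_succ)
  have hcint (κ : Measure ℝ) [IsProbabilityMeasure κ] :
      Integrable fun ξ : ℝ => charFun κ (2 * Real.pi * ξ) * 𝓕 F ξ :=
    hFint.bdd_mul (c := 1) (by fun_prop) (.of_forall fun ξ => norm_charFun_le_one _)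
  have hdiff : (((∫ x, f x ∂μ) - ∫ x, f x ∂ν : ℝ) : ℂ) =
      ∫ ξ : ℝ, (charFun μ (2 * Real.pi * ξ) - charFun ν (2 * Real.pi * ξ)) * 𝓕 F ξ := by
    have he (κ : Measure ℝ) [IsProbabilityMeasure κ] :
        ((∫ x, f x ∂κ : ℝ) : ℂ) = ∫ ξ : ℝ, charFun κ (2 * Real.pi * ξ) * 𝓕 F ξ :=
      integral_complex_ofReal.symm.trans
        (integral_eq_integral_charFun_mul_fourier κ hF.continuous hFi hFint)
    rw [ofReal_sub, he, he, ← integral_sub (hcint μ) (hcint ν)]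
    simp_rw [sub_mul]
  calc |(∫ x, f x ∂μ) - ∫ x, f x ∂ν|
      = ‖∫ ξ : ℝ, (charFun μ (2 * Real.pi * ξ) - charFun ν (2 * Real.pi * ξ)) * 𝓕 F ξ‖ := by
        rw [← hdiff, norm_real, Real.norm_eq_abs]
    _ ≤ ∫ ξ, δ * ‖𝓕 (iteratedDeriv p F) ξ‖ := by
        refine norm_integral_le_of_norm_le (hgi.norm.const_mul δ) (.of_forall fun ξ => ?_)
        rw [hfour, norm_mul, norm_smul, ← mul_assoc]
        gcongr
        refine (hδ _).trans_eq ?_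
        simp [mul_pow, abs_mul]
    _ ≤ δ * ((1 + Real.pi) / 2 * (M * √(8 * A))) := by
        rw [integral_const_mul]
        gcongr

/-- **Theorem 2.2 (transfer principle, polynomial tails).** Fix `p, γ, C`. There is a
threshold `ε₀ > 0` (depending only on `p, γ, C`) and, for every `C' > 0`, a constant
`K > 0` (depending only on `p, γ, C, C'`) such that for any real random variables
`X, Y` whose characteristic functions satisfy (H1) `|ψ(ξ) − φ(ξ)| ≤ C' ε |ξ|^p` with
`0 < ε < 1`, and which satisfy the polynomial tail bound (H2'), if `ε < ε₀` then
`W_{p+1}(X,Y) ≤ K ε^{2γ/(2γ+1)}`. -/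
theorem stein_tikhomirov_transfer_polynomial (p : ℕ) (γ C : ℝ) (hγ : 0 < γ) (hC : 0 < C) :
    ∃ ε₀ > (0 : ℝ), ∀ C' : ℝ, 0 < C' →
      ∃ K > (0 : ℝ),
        ∀ (Ω : Type) (_ : MeasureSpace Ω) (_ : IsProbabilityMeasure (ℙ : Measure Ω))
          (X Y : Ω → ℝ), Measurable X → Measurable Y →
          ∀ ε : ℝ, 0 < ε → ε < 1 → ε < ε₀ →
          -- (H1): pointwise bound on the difference of characteristic functions
          (∀ ξ : ℝ, ‖(∫ ω, Complex.exp (Complex.I * ξ * Y ω)) -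
              (∫ ω, Complex.exp (Complex.I * ξ * X ω))‖ ≤ C' * ε * |ξ| ^ p) →
          -- (H2'): polynomial tails for X and Y
          (∀ A : ℝ, 0 < A → ℙ {ω | A < |X ω|} ≤ ENNReal.ofReal (C * A ^ (-γ))) →
          (∀ A : ℝ, 0 < A → ℙ {ω | A < |Y ω|} ≤ ENNReal.ofReal (C * A ^ (-γ))) →
          -- conclusion: W_{p+1}(X,Y) ≤ K ε^{2γ/(2γ+1)}
          ∀ h : ℝ → ℝ, ContDiff ℝ (p + 1) h →
            (∀ k ≤ p + 1, ∀ x, |iteratedDeriv k h x| ≤ 1) →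
            |(∫ ω, h (X ω)) - (∫ ω, h (Y ω))| ≤ K * ε ^ (2 * γ / (2 * γ + 1)) := by
  obtain ⟨M, hM, htrunc⟩ := exists_truncation (p + 1)
  refine ⟨1, one_pos, fun C' hC' => ⟨2 * C + C' * ((1 + Real.pi) / 2 * (M * √8)),
    by positivity, ?_⟩⟩
  intro Ω _ _ X Y hX hY ε hε hε1 _ hchar htX htY h hh hh1
  have hγ' : 0 < 2 * γ + 1 := by positivity
  set A : ℝ := ε ^ (-(2 / (2 * γ + 1))) with hAdef
  have hA : 1 ≤ A :=
    Real.one_le_rpow_of_pos_of_le_one_of_nonpos hε hε1.le (by rw [neg_nonpos]; positivity)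
  have hA0 : 0 < A := one_pos.trans_le hA
  have hAγ : A ^ (-γ) = ε ^ (2 * γ / (2 * γ + 1)) := by
    rw [hAdef, ← Real.rpow_mul hε.le]
    congr 1
    field_simp
  have hAsqrt : ε * √A = ε ^ (2 * γ / (2 * γ + 1)) := by
    rw [hAdef, Real.sqrt_eq_rpow, ← Real.rpow_mul hε.le, ← Real.rpow_one_add' hε.le]
    · congr 1
      field_simp
      ring
    · field_simp
      ring_nf
      positivity
  obtain ⟨f, hf, hfs, hfM, hfh, hle⟩ := htrunc A hA h (by exact_mod_cast hh) hh1
  have hbound {u : ℝ → ℝ} (hu : Continuous u) {b : ℝ} (hb : ∀ x, |u x| ≤ b) (μ : Measure ℝ)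
      [IsProbabilityMeasure μ] : Integrable u μ :=
    .of_bound hu.aestronglyMeasurable b (.of_forall hb)
  have hhi := hbound hh.continuous (b := 1) fun x => by simpa using hh1 0 (Nat.zero_le _) x
  have hfi := hbound hf.continuous (b := M) fun x => by simpa using hfM 0 (Nat.zero_le _) x
  have hμ : IsProbabilityMeasure ((ℙ : Measure Ω).map X) :=
    Measure.isProbabilityMeasure_map hX.aemeasurable
  have hν : IsProbabilityMeasure ((ℙ : Measure Ω).map Y) :=
    Measure.isProbabilityMeasure_map hY.aemeasurable
  have hmeas : MeasurableSet {x : ℝ | A < |x|} := measurableSet_lt measurable_const (by fun_prop)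
  have h1 := abs_integral_sub_le_of_eqOn (hhi ((ℙ : Measure Ω).map X)) (hfi _)
    (t := C * A ^ (-γ)) (by positivity) hfh hle
    (by rw [Measure.map_apply hX hmeas]; exact htX A hA0)
  have h2 := abs_integral_sub_le_of_eqOn (hhi ((ℙ : Measure Ω).map Y)) (hfi _)
    (t := C * A ^ (-γ)) (by positivity) hfh hle
    (by rw [Measure.map_apply hY hmeas]; exact htY A hA0)
  have hcf {Z : Ω → ℝ} (hZ : Measurable Z) (ξ : ℝ) :
      charFun ((ℙ : Measure Ω).map Z) ξ = ∫ ω, Complex.exp (Complex.I * ξ * Z ω) := by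
    rw [charFun_apply_real, integral_map hZ.aemeasurable (by fun_prop)]
    congr! 3
    ring
  have h3 := abs_integral_sub_integral_le_of_charFun (μ := (ℙ : Measure Ω).map X)
    (ν := (ℙ : Measure Ω).map Y) (p := p) (δ := C' * ε) hA0 hM (fun ξ => by
      rw [hcf hX, hcf hY, norm_sub_rev]
      exact hchar ξ) hf hfs hfM
  rw [← integral_map hX.aemeasurable hh.continuous.aestronglyMeasurable,
    ← integral_map hY.aemeasurable hh.continuous.aestronglyMeasurable]
  have hK : C' * ε * ((1 + Real.pi) / 2 * (M * √(8 * A))) =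
      C' * ((1 + Real.pi) / 2 * (M * √8)) * ε ^ (2 * γ / (2 * γ + 1)) := by
    rw [← hAsqrt, Real.sqrt_mul (by norm_num)]
    ring
  rw [hK] at h3
  rw [hAγ] at h1 h2
  rw [abs_le] at *
  constructor <;> linarith
end

section
/- Let θ > 0 and let Z_θ be an integrable real random variable whose characteristic function is t ↦ exp(θ ∫₀¹ (e^{itx} − 1)/x dx) (the generalized Dickman distribution with parameter θ). Let U be uniformly distributed on [0,1] and independent of Z_θ. Then for every bounded measurable function φ : ℝ → ℝ, E[Z_θ φ(Z_θ)] = θ · E[φ(Z_θ + U)]. -/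
open MeasureTheory ProbabilityTheory Complex

lemma hasDerivAt_cexp_I_mul_ofReal_mul (z : ℂ) (t : ℝ) :
    HasDerivAt (fun s : ℝ ↦ cexp (I * s * z)) (I * z * cexp (I * t * z)) t := by
  have h : HasDerivAt (fun s : ℝ ↦ I * (s : ℂ) * z) (I * 1 * z) t :=
    ((HasDerivAt.ofReal_comp (hasDerivAt_id t)).const_mul I).mul_const z
  convert h.cexp using 1
  ring

lemma norm_cexp_I_mul_ofReal_mul_ofReal (t x : ℝ) : ‖cexp (I * t * x)‖ = 1 := by
  rw [mul_assoc, ← ofReal_mul, norm_exp_I_mul_ofReal]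

lemma hasDerivAt_integral_cexp {Ω : Type*} [MeasurableSpace Ω] {μ : Measure Ω}
    [IsFiniteMeasure μ] {Z : Ω → ℝ} (hZ : Measurable Z) (hint : Integrable Z μ) (t : ℝ) :
    HasDerivAt (fun s : ℝ ↦ ∫ ω, cexp (I * s * Z ω) ∂μ)
      (∫ ω, I * Z ω * cexp (I * t * Z ω) ∂μ) t := by
  refine (hasDerivAt_integral_of_dominated_loc_of_deriv_le (bound := fun ω ↦ ‖Z ω‖)
    (F' := fun (s : ℝ) ω ↦ I * Z ω * cexp (I * s * Z ω)) Filter.univ_mem (.of_forall fun s ↦ ?_) ?_ ?_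
    (.of_forall fun ω s _ ↦ ?_) hint.norm
    (.of_forall fun ω s _ ↦ hasDerivAt_cexp_I_mul_ofReal_mul _ s)).2
  · exact (by fun_prop : Measurable fun ω ↦ cexp (I * s * Z ω)).aestronglyMeasurable
  · refine .of_bound (C := 1)
      (by fun_prop : Measurable fun ω ↦ cexp (I * t * Z ω)).aestronglyMeasurable
      (.of_forall fun ω ↦ (norm_cexp_I_mul_ofReal_mul_ofReal _ _).le)
  · exact (by fun_prop : Measurable fun ω ↦ I * Z ω * cexp (I * t * Z ω)).aestronglyMeasurable
  · simp [norm_cexp_I_mul_ofReal_mul_ofReal]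

/-- The derivative of the exponent of the Dickman characteristic function. -/
lemma hasDerivAt_intervalIntegral_cexp_sub_one_div (t : ℝ) :
    HasDerivAt (fun s : ℝ ↦ ∫ x in (0 : ℝ)..1, (cexp (I * s * x) - 1) / x)
      (∫ x in (0 : ℝ)..1, I * cexp (I * t * x)) t := by
  have hmeas (s : ℝ) : Measurable fun x : ℝ ↦ (cexp (I * s * x) - 1) / x := by fun_prop
  refine (intervalIntegral.hasDerivAt_integral_of_dominated_loc_of_deriv_le
    (bound := fun _ ↦ (1 : ℝ)) (F' := fun (s x : ℝ) ↦ I * cexp (I * s * x)) Filter.univ_mem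
    (.of_forall fun s ↦ (hmeas s).aestronglyMeasurable) ?_ ?_
    (.of_forall fun x _ s _ ↦ ?_) intervalIntegrable_const
    (.of_forall fun x hx s _ ↦ ?_)).2
  · refine (intervalIntegrable_const (c := |t|)).mono_fun (hmeas t).aestronglyMeasurable
      (.of_forall fun x ↦ ?_)
    simp only
    rw [norm_div, norm_real, mul_assoc, ← ofReal_mul, Real.norm_eq_abs |t|, abs_abs]
    refine div_le_of_le_mul₀ (norm_nonneg _) (abs_nonneg _) ?_
    refine Real.norm_exp_I_mul_ofReal_sub_one_le.trans ?_
    rw [norm_mul, Real.norm_eq_abs t]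
  · exact (by fun_prop : Measurable fun x : ℝ ↦ I * cexp (I * t * x)).aestronglyMeasurable
  · simp [norm_cexp_I_mul_ofReal_mul_ofReal]
  · have hx0 : (x : ℂ) ≠ 0 := by
      rw [Set.uIoc_of_le zero_le_one] at hx
      exact_mod_cast hx.1.ne'
    refine (((hasDerivAt_cexp_I_mul_ofReal_mul x s).sub_const 1).div_const (x : ℂ)).congr_deriv ?_
    field_simp

lemma integral_map_withDensity_ofReal {Ω E : Type*} [MeasurableSpace Ω] {μ : Measure Ω}
    [NormedAddCommGroup E] [NormedSpace ℝ E] {g Z : Ω → ℝ} (hg : Measurable g)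
    (hZ : Measurable Z) {f : ℝ → E} (hf : StronglyMeasurable f) :
    ∫ x, f x ∂((μ.withDensity fun ω ↦ ENNReal.ofReal (g ω)).map Z)
      = ∫ ω, max (g ω) 0 • f (Z ω) ∂μ := by
  rw [integral_map hZ.aemeasurable hf.aestronglyMeasurable,
    integral_withDensity_eq_integral_toReal_smul (by fun_prop)
      (.of_forall fun _ ↦ ENNReal.ofReal_lt_top)]
  simp_rw [ENNReal.toReal_ofReal']

/-- If the signed law `Z · μ` pushed forward by `Z` and a nonnegative multiple of the law of `W`
have the same Fourier transform, then they agree against bounded measurable functions. -/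
lemma integral_mul_comp_eq_of_integral_mul_cexp_eq {Ω : Type*} [MeasurableSpace Ω]
    {μ : Measure Ω} [IsFiniteMeasure μ] {Z W : Ω → ℝ} (hZ : Measurable Z) (hW : Measurable W)
    (hint : Integrable Z μ) {c : ℝ} (hc : 0 ≤ c)
    (h : ∀ t : ℝ, ∫ ω, Z ω * cexp (I * t * Z ω) ∂μ = c * ∫ ω, cexp (I * t * W ω) ∂μ)
    {φ : ℝ → ℝ} (hφ : Measurable φ) {M : ℝ} (hM : ∀ x, |φ x| ≤ M) :
    ∫ ω, Z ω * φ (Z ω) ∂μ = c * ∫ ω, φ (W ω) ∂μ := by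
  set A := (μ.withDensity fun ω ↦ ENNReal.ofReal (Z ω)).map Z with hA
  set B := (μ.withDensity fun ω ↦ ENNReal.ofReal (-Z ω)).map Z with hB
  set C := ENNReal.ofReal c • μ.map W with hC
  have := isFiniteMeasure_withDensity_ofReal hint.2
  have := isFiniteMeasure_withDensity_ofReal hint.neg.2
  have : IsFiniteMeasure A := by infer_instance
  have : IsFiniteMeasure B := Measure.isFiniteMeasure_map _ _
  have : IsFiniteMeasure C := (μ.map W).smul_finite ENNReal.ofReal_ne_top
  have key {E : Type} [NormedAddCommGroup E] [NormedSpace ℝ E] [CompleteSpace E] {f : ℝ → E}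
      (hf : StronglyMeasurable f) {K : ℝ} (hK : ∀ x, ‖f x‖ ≤ K) :
      ∫ x, f x ∂A - ∫ x, f x ∂B = ∫ ω, Z ω • f (Z ω) ∂μ ∧
        ∫ x, f x ∂C = c • ∫ ω, f (W ω) ∂μ := by
    have hfZ : AEStronglyMeasurable (fun ω ↦ f (Z ω)) μ :=
      (hf.comp_measurable hZ).aestronglyMeasurable
    have hb : ∀ᵐ ω ∂μ, ‖f (Z ω)‖ ≤ K := .of_forall fun ω ↦ hK _
    constructor
    · rw [hA, hB, integral_map_withDensity_ofReal hZ hZ hf,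
        integral_map_withDensity_ofReal (g := fun ω ↦ -Z ω) hZ.neg hZ hf,
        ← integral_sub (f := fun ω ↦ max (Z ω) 0 • f (Z ω))
          (g := fun ω ↦ max (-Z ω) 0 • f (Z ω)) (hint.pos_part.smul_bdd K hfZ hb)
          (hint.neg_part.smul_bdd K hfZ hb)]
      refine integral_congr_ae (.of_forall fun ω ↦ ?_)
      simp only [← sub_smul]
      congr 1
      rcases le_total (Z ω) 0 with h0 | h0 <;> simp [h0]
    · rw [hC, integral_smul_measure, ENNReal.toReal_ofReal hc,
        integral_map hW.aemeasurable hf.aestronglyMeasurable]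
  have hABC : A = B + C := by
    refine Measure.ext_of_charFun (funext fun t ↦ ?_)
    have hmeas : StronglyMeasurable fun x : ℝ ↦ cexp (I * t * x) :=
      (by fun_prop : Continuous fun x : ℝ ↦ cexp (I * t * x)).stronglyMeasurable
    have hbd (x : ℝ) := (norm_cexp_I_mul_ofReal_mul_ofReal t x).le
    obtain ⟨h1, h2⟩ := key hmeas hbd
    have hI (ν : Measure ℝ) [IsFiniteMeasure ν] : Integrable (fun x : ℝ ↦ cexp (I * t * x)) ν :=
      .of_bound hmeas.aestronglyMeasurable 1 (.of_forall hbd)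
    simp only [charFun_apply_real, mul_comm _ I, ← mul_assoc]
    rw [integral_add_measure (hI B) (hI C), ← sub_eq_iff_eq_add', h1, h2]
    simpa only [real_smul] using h t
  obtain ⟨h1, h2⟩ := key hφ.stronglyMeasurable hM
  have hI (ν : Measure ℝ) [IsFiniteMeasure ν] : Integrable φ ν :=
    .of_bound hφ.aestronglyMeasurable M (.of_forall hM)
  rw [hABC, integral_add_measure (hI B) (hI C), add_sub_cancel_left] at h1
  exact h1.symm.trans h2

/-- **Proposition 5.1 (third bullet).** If `Z` has the generalized Dickman
distribution with parameter `θ > 0` (characterized by its characteristic function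
`t ↦ exp(θ ∫₀¹ (e^{itx} − 1)/x dx)`), is integrable, and `U` is uniform on `[0,1]`
and independent of `Z`, then for every bounded measurable `φ : ℝ → ℝ`,
`E[Z φ(Z)] = θ E[φ(Z + U)]`. -/
theorem dickman_additive_size_bias
    {Ω : Type*} [MeasureSpace Ω] [IsProbabilityMeasure (ℙ : Measure Ω)]
    (θ : ℝ) (hθ : 0 < θ)
    (Z U : Ω → ℝ) (hZmeas : Measurable Z) (hUmeas : Measurable U)
    (hZint : Integrable Z ℙ)
    -- Z has the generalized Dickman distribution with parameter θ
    (hZdick : ∀ t : ℝ, (∫ ω, Complex.exp (Complex.I * t * Z ω)) =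
      Complex.exp (θ * ∫ x in (0 : ℝ)..1, (Complex.exp (Complex.I * t * x) - 1) / x))
    -- U is uniform on [0,1] and independent of Z
    (hU : Measure.map U ℙ = volume.restrict (Set.Icc (0 : ℝ) 1))
    (hindep : IndepFun Z U ℙ) :
    ∀ φ : ℝ → ℝ, Measurable φ → (∃ M : ℝ, ∀ x, |φ x| ≤ M) →
      (∫ ω, Z ω * φ (Z ω)) = θ * ∫ ω, φ (Z ω + U ω) := by
  rintro φ hφ ⟨M, hM⟩
  refine integral_mul_comp_eq_of_integral_mul_cexp_eq hZmeas (hZmeas.add hUmeas) hZint hθ.le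
    (fun t ↦ ?_) hφ hM
  have hderiv := ((hasDerivAt_intervalIntegral_cexp_sub_one_div t).const_mul (θ : ℂ)).cexp
  simp_rw [← hZdick] at hderiv
  have heq := (hasDerivAt_integral_cexp hZmeas hZint t).unique hderiv
  have hUint : ∫ ω, cexp (I * t * U ω) = ∫ x in (0 : ℝ)..1, cexp (I * t * x) := by
    rw [intervalIntegral.integral_of_le zero_le_one, ← integral_Icc_eq_integral_Ioc, ← hU,
      integral_map hUmeas.aemeasurable
        (by fun_prop : Continuous fun x : ℝ ↦ cexp (I * t * x)).aestronglyMeasurable]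
  have hprod : ∫ ω, cexp (I * t * (Z ω + U ω : ℝ)) =
      (∫ ω, cexp (I * t * Z ω)) * ∫ ω, cexp (I * t * U ω) := by
    simp_rw [ofReal_add, mul_add, Complex.exp_add]
    exact hindep.integral_fun_comp_mul_comp hZmeas.aemeasurable hUmeas.aemeasurable
      (by fun_prop : Continuous fun x : ℝ ↦ cexp (I * t * x)).aestronglyMeasurable
      (by fun_prop : Continuous fun x : ℝ ↦ cexp (I * t * x)).aestronglyMeasurable
  simp_rw [mul_assoc I (Z _ : ℂ)] at heq
  rw [integral_const_mul, intervalIntegral.integral_const_mul, ← hUint] at heq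
  refine mul_left_cancel₀ I_ne_zero (heq.trans ?_)
  simp only [Pi.add_apply]
  rw [hprod]
  ring
end

section
/- Let (p_j)_{j≥1} be the increasing enumeration of the prime numbers and set Z_n = (1/log p_n) Σ_{k=1}^n (log p_k)/(p_k + 1). Then 1 − Z_n = O(log log n / log n); that is, there exist C > 0 and N ≥ 3 such that for all n ≥ N, |1 − Z_n| ≤ C · log log n / log n. -/
open Finset

/-- `nthPrime j` is the `j`-th prime number (1-indexed): `nthPrime 1 = 2`,
`nthPrime 2 = 3`, …, the increasing enumeration of the primes. -/
noncomputable def nthPrime (j : ℕ) : ℕ := Nat.nth Nat.Prime (j - 1)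

theorem log_factorial_eq_sum_primesLE (n : ℕ) :
    Real.log (n.factorial : ℝ) =
      ∑ p ∈ n.primesLE, (n.factorial.factorization p : ℝ) * Real.log p := by
  rw [Real.log_nat_eq_sum_factorization]
  refine Finsupp.sum_of_support_subset _ (fun p hp => ?_) _ (by simp)
  rw [Nat.support_factorization, Nat.mem_primeFactors] at hp
  rw [Nat.mem_primesLE]
  exact ⟨(hp.1.dvd_factorial).1 hp.2.1, hp.1⟩

theorem sub_one_le_factorization_factorial {n p : ℕ} (hp : p.Prime) (hpn : p ≤ n) :
    (n : ℝ) / p - 1 ≤ n.factorial.factorization p := by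
  have h : n / p ≤ n.factorial.factorization p := by
    rw [Nat.factorization_factorial hp (Nat.lt_add_one (Nat.log p n))]
    have hlog : 0 < Nat.log p n := Nat.log_pos hp.one_lt hpn
    simpa using Finset.single_le_sum (f := fun i => n / p ^ i) (fun _ _ => Nat.zero_le _)
      (Finset.mem_Ico.2 ⟨le_rfl, by omega⟩ : 1 ∈ Finset.Ico 1 (Nat.log p n + 1))
  have h' : ((n / p : ℕ) : ℝ) ≤ n.factorial.factorization p := by exact_mod_cast h
  rw [← Nat.floor_div_eq_div (K := ℝ)] at h'
  linarith [Nat.sub_one_lt_floor ((n : ℝ) / p)]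

theorem factorization_factorial_le_div_sub_one {n p : ℕ} (hp : p.Prime) :
    (n.factorial.factorization p : ℝ) ≤ n / ((p : ℝ) - 1) := by
  have h : (n.factorial.factorization p : ℝ) ≤ ((n / (p - 1) : ℕ) : ℝ) := by
    exact_mod_cast Nat.factorization_factorial_le_div_pred hp n
  refine h.trans (Nat.cast_div_le.trans_eq ?_)
  rw [Nat.cast_sub hp.one_le, Nat.cast_one]

/-- The sums of `log k / (k - 1) - log k / (k + 1)` over integers `k ≥ 2` are bounded. -/
theorem exists_sum_log_mul_sub_le :
    ∃ B : ℝ, ∀ s : Finset ℕ, (∀ k ∈ s, 2 ≤ k) →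
      ∑ k ∈ s, (Real.log k / ((k : ℝ) - 1) - Real.log k / ((k : ℝ) + 1)) ≤ B := by
  have hs : Summable fun k : ℕ => 16 / 3 * (k : ℝ) ^ (-(3 / 2) : ℝ) :=
    (Real.summable_nat_rpow.2 (by norm_num)).mul_left _
  refine ⟨∑' k : ℕ, 16 / 3 * (k : ℝ) ^ (-(3 / 2) : ℝ), fun s h2 => ?_⟩
  refine (Finset.sum_le_sum fun k hk => ?_).trans
    (hs.sum_le_tsum s fun k _ => by positivity)
  have hk2 : (2 : ℝ) ≤ k := by exact_mod_cast h2 k hk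
  have hlog : Real.log k ≤ (k : ℝ) ^ (1 / 2 : ℝ) / (1 / 2) :=
    Real.log_le_rpow_div (by positivity) (by norm_num)
  have hpow : (k : ℝ) ^ (1 / 2 : ℝ) = (k : ℝ) ^ (-(3 / 2) : ℝ) * (k : ℝ) ^ 2 := by
    rw [← Real.rpow_natCast, ← Real.rpow_add (by positivity)]
    norm_num
  rw [hpow] at hlog
  have hy : 0 ≤ (k : ℝ) ^ (-(3 / 2) : ℝ) := by positivity
  set y := (k : ℝ) ^ (-(3 / 2) : ℝ)
  have h1 : (0 : ℝ) < (k : ℝ) - 1 := by linarith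
  have h1' : (0 : ℝ) < (k : ℝ) + 1 := by linarith
  rw [div_sub_div _ _ h1.ne' h1'.ne', div_le_iff₀ (mul_pos h1 h1')]
  nlinarith [mul_nonneg hy (by nlinarith : (0 : ℝ) ≤ (k : ℝ) ^ 2 - 4)]

theorem sum_log_div_add_one_le {n : ℕ} (hn : n ≠ 0) :
    ∑ p ∈ n.primesLE, Real.log p / ((p : ℝ) + 1) ≤ Real.log n + Real.log 4 := by
  have hn0 : (0 : ℝ) < n := by positivity
  have hfac : Real.log (n.factorial : ℝ) ≤ n * Real.log n := by
    rw [← Real.log_pow]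
    exact Real.log_le_log (by positivity) (by exact_mod_cast Nat.factorial_le_pow n)
  have htheta : ∑ p ∈ n.primesLE, Real.log p ≤ Real.log 4 * n := by
    rw [← Chebyshev.theta_eq_sum_primesLE_log]
    exact Chebyshev.theta_le_log4_mul_x hn0.le
  have hsum : ∑ p ∈ n.primesLE, (n * (Real.log p / ((p : ℝ) + 1)) - Real.log p) ≤
      Real.log (n.factorial : ℝ) := by
    rw [log_factorial_eq_sum_primesLE]
    refine Finset.sum_le_sum fun p hp => ?_
    obtain ⟨hpn, hp⟩ := Nat.mem_primesLE.1 hp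
    have hp0 : (0 : ℝ) < p := by exact_mod_cast hp.pos
    have hlog : 0 ≤ Real.log p := Real.log_natCast_nonneg p
    calc n * (Real.log p / ((p : ℝ) + 1)) - Real.log p
        ≤ n * (Real.log p / p) - Real.log p := by gcongr; linarith
      _ = ((n : ℝ) / p - 1) * Real.log p := by ring
      _ ≤ _ := by gcongr; exact sub_one_le_factorization_factorial hp hpn
  rw [Finset.sum_sub_distrib, ← Finset.mul_sum] at hsum
  refine le_of_mul_le_mul_left ?_ hn0
  linarith

theorem log_sub_one_le_sum_log_div_sub_one {n : ℕ} (hn : n ≠ 0) :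
    Real.log n - 1 ≤ ∑ p ∈ n.primesLE, Real.log p / ((p : ℝ) - 1) := by
  have hn0 : (0 : ℝ) < n := by positivity
  have hfac := Stirling.le_log_factorial_stirling hn
  have hlogn : 0 ≤ Real.log n := Real.log_natCast_nonneg n
  have hpi : 0 ≤ Real.log (2 * Real.pi) := Real.log_nonneg (by linarith [Real.pi_gt_three])
  have hsum : Real.log (n.factorial : ℝ) ≤
      n * ∑ p ∈ n.primesLE, Real.log p / ((p : ℝ) - 1) := by
    rw [log_factorial_eq_sum_primesLE, Finset.mul_sum]
    refine Finset.sum_le_sum fun p hp => ?_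
    calc (n.factorial.factorization p : ℝ) * Real.log p
        ≤ n / ((p : ℝ) - 1) * Real.log p := by
          gcongr
          exact factorization_factorial_le_div_sub_one (Nat.mem_primesLE.1 hp).2
      _ = _ := by ring
  refine le_of_mul_le_mul_left ?_ hn0
  linarith

/-- A form of Mertens' first theorem. -/
theorem exists_abs_log_sub_sum_log_div_add_one_le :
    ∃ C : ℝ, ∀ n : ℕ, n ≠ 0 →
      |Real.log n - ∑ p ∈ n.primesLE, Real.log p / ((p : ℝ) + 1)| ≤ C := by
  obtain ⟨B, hB⟩ := exists_sum_log_mul_sub_le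
  refine ⟨max (1 + B) (Real.log 4), fun n hn => ?_⟩
  have hupper := sum_log_div_add_one_le hn
  have hlower := log_sub_one_le_sum_log_div_sub_one hn
  have hdiff := hB n.primesLE fun p hp => (Nat.mem_primesLE.1 hp).2.two_le
  rw [Finset.sum_sub_distrib] at hdiff
  rw [abs_le]
  constructor
  · linarith [le_max_right (1 + B) (Real.log 4)]
  · linarith [le_max_left (1 + B) (Real.log 4)]

theorem sum_Icc_nthPrime {M : Type*} [AddCommMonoid M] (f : ℕ → M) {n : ℕ} (hn : n ≠ 0) :
    ∑ k ∈ Finset.Icc 1 n, f (nthPrime k) = ∑ p ∈ (nthPrime n).primesLE, f p := by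
  obtain ⟨m, rfl⟩ := Nat.exists_eq_succ_of_ne_zero hn
  rw [← Finset.sum_image (f := f) (g := nthPrime) (s := Finset.Icc 1 (m + 1))]
  · congr 1
    ext p
    simp only [Finset.mem_image, Finset.mem_Icc, Nat.mem_primesLE, nthPrime]
    constructor
    · rintro ⟨k, hk, rfl⟩
      exact ⟨Nat.nth_monotone Nat.infinite_setOfPred_prime (by omega), Nat.prime_nth_prime _⟩
    · rintro ⟨hle, hp⟩
      refine ⟨Nat.count Nat.Prime p + 1, ⟨by omega, ?_⟩, by simpa using Nat.nth_count hp⟩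
      rw [← Nat.nth_count hp, Nat.nth_le_nth Nat.infinite_setOfPred_prime] at hle
      omega
  · intro a ha b hb hab
    have := Nat.nth_injective Nat.infinite_setOfPred_prime hab
    simp only [Finset.coe_Icc, Set.mem_Icc] at ha hb
    omega

/-- **Lemma 5.7 (first part, `ConvLaw2`).** With
`Z_n = (1/log p_n) Σ_{k=1}^n (log p_k)/(p_k + 1)`, one has
`1 − Z_n = O(log log n / log n)`: there are `C > 0` and `N ≥ 3` such that
`|1 − Z_n| ≤ C log log n / log n` for all `n ≥ N`. -/
theorem prime_Zn_asymptotics :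
    ∃ C > (0 : ℝ), ∃ N : ℕ, 3 ≤ N ∧ ∀ n : ℕ, N ≤ n →
      |1 - (1 / Real.log (nthPrime n)) *
          ∑ k ∈ Finset.Icc 1 n, Real.log (nthPrime k) / ((nthPrime k : ℝ) + 1)| ≤
        C * Real.log (Real.log n) / Real.log n := by
  obtain ⟨C, hC⟩ := exists_abs_log_sub_sum_log_div_add_one_le
  have hC0 : 0 ≤ C := (abs_nonneg _).trans (hC 1 one_ne_zero)
  refine ⟨C + 1, by linarith, 27, by norm_num, fun n hn => ?_⟩
  have hlog : Real.exp 1 ≤ Real.log n := by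
    have h3 : 1 ≤ Real.log 3 :=
      (Real.le_log_iff_exp_le (by norm_num)).2 Real.exp_one_lt_three.le
    have h27 : Real.log 27 = 3 * Real.log 3 := by
      rw [show (27 : ℝ) = 3 ^ 3 by norm_num, Real.log_pow, Nat.cast_ofNat]
    have hle : Real.log 27 ≤ Real.log n := Real.log_le_log (by norm_num) (by exact_mod_cast hn)
    linarith [Real.exp_one_lt_three]
  have hlog0 : 0 < Real.log n := (Real.exp_pos 1).trans_le hlog
  have hloglog : 1 ≤ Real.log (Real.log n) := (Real.le_log_iff_exp_le hlog0).2 hlog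
  have hnp : n ≤ nthPrime n := by
    have := Nat.add_two_le_nth_prime (n - 1)
    unfold nthPrime
    omega
  have hlogp : Real.log n ≤ Real.log (nthPrime n) :=
    Real.log_le_log (by exact_mod_cast (by omega : 0 < n)) (by exact_mod_cast hnp)
  have hlogp0 : 0 < Real.log (nthPrime n) := hlog0.trans_le hlogp
  rw [sum_Icc_nthPrime (fun p => Real.log p / ((p : ℝ) + 1)) (by omega), one_div_mul_eq_div,
    one_sub_div hlogp0.ne', abs_div, abs_of_pos hlogp0]
  calc _ ≤ C / Real.log (nthPrime n) := by gcongr; exact hC _ (by omega)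
    _ ≤ C / Real.log n := by gcongr
    _ ≤ (C + 1) * Real.log (Real.log n) / Real.log n := by gcongr; nlinarith
end

section
/- Let α ∈ (1,2) and let X be an integrable real random variable with characteristic function φ_X. Define, for ν ≠ 0, φ_X^*(ν) = −ν/(α|ν|^α) · E[iX e^{iνX}]. Then for every ξ > 0, φ_X(ξ) − e^{−ξ^α} = α e^{−ξ^α} ∫₀^ξ ν^{α−1} e^{ν^α} ( φ_X(ν) − φ_X^*(ν) ) dν, and for every ξ < 0, φ_X(ξ) − e^{−(−ξ)^α} = α e^{−(−ξ)^α} ∫_ξ^0 (−ν)^{α−1} e^{(−ν)^α} ( φ_X(ν) − φ_X^*(ν) ) dν. -/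
open MeasureTheory ProbabilityTheory Complex

/-- Solution of the linear equation satisfied by `f` on `[0, ξ]` with integrating factor
`exp (ν ^ α)`, where `s` is the transform `-ν / (α * ν ^ α) * f' ν`. -/
theorem sub_exp_neg_rpow_eq_integral {α : ℝ} (hα : 1 < α) {f f' s : ℝ → ℂ}
    (hf : ∀ ν, HasDerivAt f (f' ν) ν) (hf' : Continuous f') (hf0 : f 0 = 1)
    (hs : ∀ ν, 0 < ν → s ν = ((-ν / (α * ν ^ α) : ℝ) : ℂ) * f' ν) {ξ : ℝ} (hξ : 0 < ξ) :
    f ξ - (Real.exp (-(ξ ^ α)) : ℂ) =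
      ((α * Real.exp (-(ξ ^ α)) : ℝ) : ℂ) *
        ∫ ν in (0 : ℝ)..ξ, ((ν ^ (α - 1) * Real.exp (ν ^ α) : ℝ) : ℂ) * (f ν - s ν) := by
  have hfc : Continuous f := continuous_iff_continuousAt.2 fun ν => (hf ν).continuousAt
  have hderiv : ∀ ν : ℝ, HasDerivAt (fun ν : ℝ => ((Real.exp (ν ^ α) : ℝ) : ℂ) * f ν)
      (((Real.exp (ν ^ α) * (α * ν ^ (α - 1)) : ℝ) : ℂ) * f ν +
        ((Real.exp (ν ^ α) : ℝ) : ℂ) * f' ν) ν := fun ν =>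
    ((Real.hasDerivAt_rpow_const (Or.inr hα.le)).exp.ofReal_comp).mul (hf ν)
  have hr : Continuous fun ν : ℝ => ν ^ α := Real.continuous_rpow_const (by linarith)
  have hr' : Continuous fun ν : ℝ => ν ^ (α - 1) := Real.continuous_rpow_const (by linarith)
  have hFTC := intervalIntegral.integral_eq_sub_of_hasDerivAt (a := 0) (b := ξ)
    (fun ν _ => hderiv ν) (Continuous.intervalIntegrable (by fun_prop) _ _)
  have hcongr : (∫ ν in (0 : ℝ)..ξ, (((Real.exp (ν ^ α) * (α * ν ^ (α - 1)) : ℝ) : ℂ) * f ν +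
        ((Real.exp (ν ^ α) : ℝ) : ℂ) * f' ν)) =
      ∫ ν in (0 : ℝ)..ξ,
        (α : ℂ) * (((ν ^ (α - 1) * Real.exp (ν ^ α) : ℝ) : ℂ) * (f ν - s ν)) := by
    refine intervalIntegral.integral_congr_ae (Filter.Eventually.of_forall fun ν hν => ?_)
    rw [Set.uIoc_of_le hξ.le] at hν
    have hν0 : 0 < ν := hν.1
    have hcoef : α * (ν ^ (α - 1) * Real.exp (ν ^ α)) * (-ν / (α * ν ^ α)) =
        -Real.exp (ν ^ α) := by
      have hpos : 0 < ν ^ α := Real.rpow_pos_of_pos hν0 α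
      rw [Real.rpow_sub_one hν0.ne']
      field_simp
    have hcoef' := congrArg ((↑) : ℝ → ℂ) hcoef
    rw [hs ν hν0]
    simp only [ofReal_mul, ofReal_neg] at hcoef' ⊢
    linear_combination f' ν * hcoef'
  rw [hcongr, intervalIntegral.integral_const_mul, hf0,
    Real.zero_rpow (by linarith : α ≠ 0)] at hFTC
  have hexp : ((Real.exp (-(ξ ^ α)) : ℝ) : ℂ) * ((Real.exp (ξ ^ α) : ℝ) : ℂ) = 1 := by
    rw [← ofReal_mul, ← Real.exp_add]
    simp
  simp only [Real.exp_zero, ofReal_one, mul_one] at hFTC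
  rw [ofReal_mul]
  linear_combination (-(Real.exp (-(ξ ^ α)) : ℂ)) * hFTC - f ξ * hexp

/-- The characteristic function of an integrable random variable is differentiable. -/
theorem hasDerivAt_integral_exp_I_mul {Ω : Type*} [MeasurableSpace Ω] {μ : Measure Ω}
    [IsFiniteMeasure μ] {X : Ω → ℝ} (hX : Integrable X μ) (ν : ℝ) :
    HasDerivAt (fun ξ : ℝ => ∫ ω, exp (I * ξ * X ω) ∂μ)
      (∫ ω, I * (X ω : ℂ) * exp (I * ν * X ω) ∂μ) ν := by
  have hm : AEStronglyMeasurable (fun ω => (X ω : ℂ)) μ :=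
    continuous_ofReal.comp_aestronglyMeasurable hX.1
  have hexp (ξ : ℝ) : AEStronglyMeasurable (fun ω => exp (I * ξ * X ω)) μ :=
    continuous_exp.comp_aestronglyMeasurable (hm.const_mul _)
  have hnorm (ξ : ℝ) (ω : Ω) : ‖exp (I * ξ * X ω)‖ = 1 := by
    rw [show I * (ξ : ℂ) * (X ω : ℂ) = ((ξ * X ω : ℝ) : ℂ) * I by push_cast; ring]
    exact norm_exp_ofReal_mul_I _
  refine (hasDerivAt_integral_of_dominated_loc_of_deriv_le (s := Set.univ) (x₀ := ν)
    (F := fun (ξ : ℝ) ω => exp (I * ξ * X ω))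
    (F' := fun (ξ : ℝ) ω => I * (X ω : ℂ) * exp (I * ξ * X ω))
    (bound := fun ω => ‖X ω‖) Filter.univ_mem
    (Filter.Eventually.of_forall hexp) ?_ ((hm.const_mul _).mul (hexp ν)) ?_ hX.norm ?_).2
  · exact (integrable_const (1 : ℝ)).mono' (hexp ν) (ae_of_all _ fun ω => (hnorm ν ω).le)
  · refine ae_of_all _ fun ω ξ _ => ?_
    rw [norm_mul, norm_mul, hnorm]
    simp
  · refine ae_of_all _ fun ω ξ _ => ?_
    have h := (((hasDerivAt_id ξ).ofReal_comp.const_mul I).mul_const (X ω : ℂ)).cexp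
    simpa [mul_comm] using h

/-- The derivative of the characteristic function of an integrable random variable is
continuous. -/
theorem continuous_integral_I_mul_exp_I_mul {Ω : Type*} [MeasurableSpace Ω] {μ : Measure Ω}
    {X : Ω → ℝ} (hX : Integrable X μ) :
    Continuous fun ν : ℝ => ∫ ω, I * (X ω : ℂ) * exp (I * ν * X ω) ∂μ := by
  have hm : AEStronglyMeasurable (fun ω => (X ω : ℂ)) μ :=
    continuous_ofReal.comp_aestronglyMeasurable hX.1
  refine continuous_of_dominated (bound := fun ω => ‖X ω‖) (fun ν => (hm.const_mul _).mul
    (continuous_exp.comp_aestronglyMeasurable (hm.const_mul _))) (fun ν => ?_) hX.norm ?_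
  · refine ae_of_all _ fun ω => ?_
    rw [norm_mul, show I * (ν : ℂ) * (X ω : ℂ) = ((ν * X ω : ℝ) : ℂ) * I by push_cast; ring,
      norm_exp_ofReal_mul_I]
    simp
  · exact ae_of_all _ fun ω => by fun_prop

/-- **Proposition B.3 (fifth bullet of `properties`).** Let `α ∈ (1,2)`, let `X` be an
integrable real random variable with characteristic function `φ_X`, and set, for
`ν ≠ 0`, `φ_X^*(ν) = −ν/(α|ν|^α) E[iX e^{iνX}]`. Then for `ξ > 0`,
`φ_X(ξ) − e^{−ξ^α} = α e^{−ξ^α} ∫₀^ξ ν^{α−1} e^{ν^α}(φ_X(ν) − φ_X^*(ν)) dν`, and the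
symmetric identity holds for `ξ < 0`. -/
theorem stable_charFun_representation
    {Ω : Type*} [MeasureSpace Ω] [IsProbabilityMeasure (ℙ : Measure Ω)]
    (α : ℝ) (hα1 : 1 < α) (hα2 : α < 2)
    (X : Ω → ℝ) (hXmeas : Measurable X) (hXint : Integrable X ℙ)
    (φX : ℝ → ℂ)
    (hφX : φX = fun ξ : ℝ => ∫ ω, Complex.exp (Complex.I * ξ * X ω))
    (φs : ℝ → ℂ)
    (hφs : ∀ ν : ℝ, ν ≠ 0 → φs ν = ((-ν / (α * |ν| ^ α) : ℝ) : ℂ) *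
      ∫ ω, Complex.I * (X ω : ℂ) * Complex.exp (Complex.I * ν * X ω)) :
    (∀ ξ : ℝ, 0 < ξ →
      φX ξ - (Real.exp (-(ξ ^ α)) : ℂ) =
        ((α * Real.exp (-(ξ ^ α)) : ℝ) : ℂ) *
          ∫ ν in (0 : ℝ)..ξ,
            ((ν ^ (α - 1) * Real.exp (ν ^ α) : ℝ) : ℂ) * (φX ν - φs ν)) ∧
    (∀ ξ : ℝ, ξ < 0 →
      φX ξ - (Real.exp (-((-ξ) ^ α)) : ℂ) =
        ((α * Real.exp (-((-ξ) ^ α)) : ℝ) : ℂ) *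
          ∫ ν in ξ..(0 : ℝ),
            (((-ν) ^ (α - 1) * Real.exp ((-ν) ^ α) : ℝ) : ℂ) * (φX ν - φs ν)) := by
  have hderiv : ∀ ν : ℝ, HasDerivAt φX
      (∫ ω, Complex.I * (X ω : ℂ) * Complex.exp (Complex.I * ν * X ω)) ν := by
    rw [hφX]
    exact hasDerivAt_integral_exp_I_mul hXint
  have hcont := continuous_integral_I_mul_exp_I_mul hXint
  have h0 : φX 0 = 1 := by simp [hφX]
  refine ⟨fun ξ hξ => ?_, fun ξ hξ => ?_⟩
  · refine sub_exp_neg_rpow_eq_integral hα1 hderiv hcont h0 (fun ν hν => ?_) hξ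
    rw [hφs ν hν.ne', abs_of_pos hν]
  · have h := sub_exp_neg_rpow_eq_integral hα1 (f := fun ν => φX (-ν)) (s := fun ν => φs (-ν))
      (f' := fun ν => -∫ ω, Complex.I * (X ω : ℂ) * Complex.exp (Complex.I * (-ν : ℝ) * X ω))
      (fun ν => by simpa [Function.comp_def] using (hderiv (-ν)).scomp ν (hasDerivAt_neg ν))
      (hcont.comp continuous_neg).neg (by simpa using h0)
      (fun ν hν => by
        rw [hφs (-ν) (neg_ne_zero.2 hν.ne'), abs_neg, abs_of_pos hν, neg_neg, neg_div,
          ofReal_neg (ν / _), neg_mul_neg])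
      (neg_pos.2 hξ)
    have hsub := intervalIntegral.integral_comp_neg (a := 0) (b := -ξ) (fun ν : ℝ =>
      (((-ν) ^ (α - 1) * Real.exp ((-ν) ^ α) : ℝ) : ℂ) * (φX ν - φs ν))
    simp only [neg_neg, neg_zero] at h hsub
    rwa [hsub] at h
end

section
/- For every α ∈ (1,2) there exists a constant C₁(α) > 0 such that for all ξ > 1, e^{−ξ^α} ∫₀^ξ e^{ν^α} dν ≤ C₁(α) e^{−ξ^α} + ξ^{1−α}, and for all 0 < ξ < 1, e^{−ξ^α} ∫₀^ξ e^{ν^α} dν ≤ C₁(α) e^{−ξ^α}. -/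
/-- Above `1`, the derivative of `x ↦ x ^ (1 - α) * exp (x ^ α)` dominates `exp (x ^ α)`. -/
lemma integral_exp_rpow_one_le {α : ℝ} (hα : 1 ≤ α) {ξ : ℝ} (hξ : 1 ≤ ξ) :
    ∫ ν in (1 : ℝ)..ξ, Real.exp (ν ^ α) ≤ ξ ^ (1 - α) * Real.exp (ξ ^ α) := by
  have hcont : Continuous fun ν : ℝ => Real.exp (ν ^ α) :=
    Real.continuous_exp.comp (Real.continuous_rpow_const (by linarith))
  have hderiv : ∀ x : ℝ, 0 < x → HasDerivAt (fun x : ℝ => x ^ (1 - α) * Real.exp (x ^ α))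
      ((1 - α) * x ^ (1 - α - 1) * Real.exp (x ^ α) +
        x ^ (1 - α) * (Real.exp (x ^ α) * (α * x ^ (α - 1)))) x := fun x hx =>
    (Real.hasDerivAt_rpow_const (Or.inl hx.ne')).mul
      (Real.hasDerivAt_rpow_const (Or.inl hx.ne')).exp
  have key := intervalIntegral.integral_le_sub_of_hasDeriv_right_of_le hξ
    (fun x hx => (hderiv x (by linarith [hx.1])).continuousAt.continuousWithinAt)
    (fun x hx => (hderiv x (by linarith [hx.1])).hasDerivWithinAt)
    hcont.continuousOn.integrableOn_Icc
    (fun x hx => by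
      have hx0 : 0 < x := by linarith [hx.1]
      have hmul : x ^ (1 - α) * x ^ (α - 1) = 1 := by
        rw [← Real.rpow_add hx0]
        simp
      have hle : x ^ (1 - α - 1) ≤ 1 :=
        Real.rpow_le_one_of_one_le_of_nonpos hx.1.le (by linarith)
      calc Real.exp (x ^ α) = 1 * Real.exp (x ^ α) := (one_mul _).symm
        _ ≤ ((1 - α) * x ^ (1 - α - 1) + α * (x ^ (1 - α) * x ^ (α - 1))) *
            Real.exp (x ^ α) := by
          gcongr
          rw [hmul]
          nlinarith
        _ = _ := by ring)
  have hpos : 0 < (1 : ℝ) ^ (1 - α) * Real.exp ((1 : ℝ) ^ α) := by positivity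
  linarith


/-- **Lemma B.4 (`DawsonStable`).** For every `α ∈ (1,2)` there is `C₁(α) > 0` such
that the Dawson-type function of the symmetric stable law satisfies
`e^{−ξ^α} ∫₀^ξ e^{ν^α} dν ≤ C₁(α) e^{−ξ^α} + ξ^{1−α}` for `ξ > 1`, and
`e^{−ξ^α} ∫₀^ξ e^{ν^α} dν ≤ C₁(α) e^{−ξ^α}` for `0 < ξ < 1`. -/
theorem dawson_stable_bound (α : ℝ) (hα1 : 1 < α) (hα2 : α < 2) :
    ∃ C > (0 : ℝ),
      (∀ ξ : ℝ, 1 < ξ →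
        Real.exp (-(ξ ^ α)) * (∫ ν in (0 : ℝ)..ξ, Real.exp (ν ^ α)) ≤
          C * Real.exp (-(ξ ^ α)) + ξ ^ (1 - α)) ∧
      (∀ ξ : ℝ, 0 < ξ → ξ < 1 →
        Real.exp (-(ξ ^ α)) * (∫ ν in (0 : ℝ)..ξ, Real.exp (ν ^ α)) ≤
          C * Real.exp (-(ξ ^ α))) := by
  have hcont : Continuous fun ν : ℝ => Real.exp (ν ^ α) :=
    Real.continuous_exp.comp (Real.continuous_rpow_const (by linarith))
  have hint : ∀ a b : ℝ, IntervalIntegrable (fun ν : ℝ => Real.exp (ν ^ α))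
      MeasureTheory.volume a b := fun a b => hcont.intervalIntegrable a b
  refine ⟨∫ ν in (0 : ℝ)..1, Real.exp (ν ^ α),
    intervalIntegral.intervalIntegral_pos_of_pos (hint 0 1) (fun _ => Real.exp_pos _) one_pos,
    fun ξ hξ => ?_, fun ξ hξ0 hξ1 => ?_⟩
  · have hcancel : Real.exp (-(ξ ^ α)) * Real.exp (ξ ^ α) = 1 := by
      rw [← Real.exp_add]
      simp
    rw [← intervalIntegral.integral_add_adjacent_intervals (hint 0 1) (hint 1 ξ)]
    calc _ ≤ Real.exp (-(ξ ^ α)) * ((∫ ν in (0 : ℝ)..1, Real.exp (ν ^ α)) +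
          ξ ^ (1 - α) * Real.exp (ξ ^ α)) := by
          gcongr
          exact integral_exp_rpow_one_le hα1.le hξ.le
      _ = (∫ ν in (0 : ℝ)..1, Real.exp (ν ^ α)) * Real.exp (-(ξ ^ α)) +
          ξ ^ (1 - α) * (Real.exp (-(ξ ^ α)) * Real.exp (ξ ^ α)) := by ring
      _ = _ := by rw [hcancel, mul_one]
  · rw [mul_comm]
    gcongr
    rw [← intervalIntegral.integral_add_adjacent_intervals (hint 0 ξ) (hint ξ 1)]
    have hnonneg : 0 ≤ ∫ ν in ξ..1, Real.exp (ν ^ α) :=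
      intervalIntegral.integral_nonneg hξ1.le fun _ _ => (Real.exp_pos _).le
    linarith
end

section
/- Let α ∈ (1,2), set c = (1−α)/(2Γ(2−α)cos(πα/2)), and let X be an integrable real random variable with E[X] = 0 whose cumulative distribution function F satisfies F(x) = 1 − (c + a₁(x))/x^α for all x > 0 and F(x) = (c + a₂(x))/(−x)^α for all x < 0, where a₁ is continuous and bounded on (0,∞) and a₂ is continuous and bounded on (−∞,0). Then there exists a constant C_α > 0 depending only on α such that for all ξ ∈ ℝ, |φ_X(ξ) − 1| ≤ C_α |ξ|^α ( 1 + ‖a₁‖_∞ + ‖a₂‖_∞ ), where φ_X is the characteristic function of X. -/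
open MeasureTheory ProbabilityTheory Complex

theorem norm_exp_I_mul_sub_one_sub_le_of_nonneg {y : ℝ} (hy : 0 ≤ y) :
    ‖Complex.exp (I * y) - 1 - I * y‖ ≤ ∫ t in (0 : ℝ)..y, min 2 t := by
  have hderiv : ∀ t ∈ Set.uIcc 0 y, HasDerivAt (fun t : ℝ => Complex.exp (I * t) - 1 - I * t)
      (I * (Complex.exp (I * t) - 1)) t := by
    intro t _
    have h1 : HasDerivAt (fun t : ℝ => I * (t : ℂ)) I t := by
      simpa using (Complex.ofRealCLM.hasDerivAt (x := t)).const_mul I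
    exact ((h1.cexp.sub_const 1).sub h1).congr_deriv (by ring)
  have hcont : Continuous (fun t : ℝ => I * (Complex.exp (I * t) - 1)) := by fun_prop
  have hftc := intervalIntegral.integral_eq_sub_of_hasDerivAt hderiv
    (hcont.intervalIntegrable 0 y)
  have heq : Complex.exp (I * y) - 1 - I * y =
      ∫ t in (0 : ℝ)..y, I * (Complex.exp (I * t) - 1) := by
    rw [hftc]; simp
  rw [heq]
  refine intervalIntegral.norm_integral_le_of_norm_le hy (ae_of_all _ fun t ht => ?_)
    ((continuous_const.min continuous_id).intervalIntegrable 0 y)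
  rw [norm_mul, norm_I, one_mul]
  refine le_min ?_ ?_
  · calc ‖Complex.exp (I * t) - 1‖ ≤ ‖Complex.exp (I * t)‖ + ‖(1 : ℂ)‖ := norm_sub_le _ _
      _ = 2 := by rw [Complex.norm_exp_I_mul_ofReal]; norm_num
  · simpa [abs_of_pos ht.1] using Real.norm_exp_I_mul_ofReal_sub_one_le (x := t)

theorem norm_exp_I_mul_sub_one_sub_le (y : ℝ) :
    ‖Complex.exp (I * y) - 1 - I * y‖ ≤ ∫ t in (0 : ℝ)..|y|, min 2 t := by
  rcases le_total 0 y with hy | hy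
  · rw [abs_of_nonneg hy]
    exact norm_exp_I_mul_sub_one_sub_le_of_nonneg hy
  · rw [abs_of_nonpos hy]
    refine le_trans (le_of_eq ?_) (norm_exp_I_mul_sub_one_sub_le_of_nonneg (neg_nonneg.2 hy))
    rw [← Complex.norm_conj]
    simp [← Complex.exp_conj]

theorem integrableOn_rpow_neg_mul_min {α : ℝ} (hα1 : 1 < α) (hα2 : α < 2) :
    IntegrableOn (fun t : ℝ => t ^ (-α) * min 2 t) (Set.Ioi 0) := by
  have hmeas : Measurable (fun t : ℝ => t ^ (-α) * min 2 t) := by fun_prop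
  rw [← Set.Ioc_union_Ioi_eq_Ioi zero_le_one]
  refine IntegrableOn.union ?_ ?_
  · have h : IntegrableOn (fun t : ℝ => t ^ (1 - α)) (Set.Ioc 0 1) := by
      rw [← intervalIntegrable_iff_integrableOn_Ioc_of_le zero_le_one]
      exact intervalIntegral.intervalIntegrable_rpow' (by linarith)
    refine Integrable.mono' h hmeas.aestronglyMeasurable ?_
    filter_upwards [ae_restrict_mem measurableSet_Ioc] with t ht
    have ht0 : 0 < t := ht.1
    rw [Real.norm_of_nonneg (by positivity), sub_eq_add_neg, add_comm, Real.rpow_add_one ht0.ne']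
    gcongr
    exact min_le_right _ _
  · have h : IntegrableOn (fun t : ℝ => t ^ (-α) * 2) (Set.Ioi 1) :=
      (integrableOn_Ioi_rpow_of_lt (by linarith) zero_lt_one).mul_const 2
    refine Integrable.mono' h hmeas.aestronglyMeasurable ?_
    filter_upwards [ae_restrict_mem measurableSet_Ioi] with t ht
    have ht0 : 0 < t := zero_lt_one.trans ht
    rw [Real.norm_of_nonneg (by positivity)]
    gcongr
    exact min_le_left _ _

theorem norm_integral_exp_sub_one_le_of_tail {Ω : Type*} [MeasurableSpace Ω] {μ : Measure Ω}
    [IsProbabilityMeasure μ] {X : Ω → ℝ} (hX : Integrable X μ) (hmean : ∫ ω, X ω ∂μ = 0)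
    {α K : ℝ} (hα1 : 1 < α) (hα2 : α < 2) (hK : 0 ≤ K)
    (htail : ∀ s : ℝ, 0 < s → μ {ω | s < |X ω|} ≤ ENNReal.ofReal (K * s ^ (-α))) (ξ : ℝ) :
    ‖(∫ ω, Complex.exp (I * ξ * X ω) ∂μ) - 1‖ ≤
      K * |ξ| ^ α * ∫ t in Set.Ioi (0 : ℝ), t ^ (-α) * min 2 t := by
  have hJ : 0 ≤ ∫ t in Set.Ioi (0 : ℝ), t ^ (-α) * min 2 t :=
    setIntegral_nonneg measurableSet_Ioi fun t (ht : 0 < t) => by positivity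
  rcases eq_or_ne ξ 0 with rfl | hξ
  · simpa using by positivity
  have hξ0 : 0 < |ξ| := abs_pos.2 hξ
  have hexp : Integrable (fun ω => Complex.exp (I * ξ * X ω)) μ := by
    refine Integrable.of_bound (C := 1) ?_ (ae_of_all _ fun ω => ?_)
    · exact (by fun_prop : Continuous fun x : ℝ => Complex.exp (I * ξ * x))
        |>.comp_aestronglyMeasurable hX.aestronglyMeasurable
    · rw [mul_assoc, ← ofReal_mul, Complex.norm_exp_I_mul_ofReal]
  have hlin : Integrable (fun ω => I * ξ * (X ω : ℂ)) μ := hX.ofReal.const_mul _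
  have hcenter : (∫ ω, Complex.exp (I * ξ * X ω) ∂μ) - 1 =
      ∫ ω, (Complex.exp (I * ξ * X ω) - 1 - I * ξ * X ω) ∂μ := by
    have hsub : Integrable (fun ω => Complex.exp (I * ξ * X ω) - 1) μ :=
      hexp.sub (integrable_const 1)
    rw [integral_sub hsub hlin, integral_sub hexp (integrable_const 1),
      integral_const_mul, integral_complex_ofReal, hmean]
    simp
  rw [hcenter]
  refine (norm_integral_le_lintegral_norm _).trans
    (ENNReal.toReal_le_of_le_ofReal (by positivity) ?_)
  calc ∫⁻ ω, ENNReal.ofReal ‖Complex.exp (I * ξ * X ω) - 1 - I * ξ * X ω‖ ∂μ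
      ≤ ∫⁻ ω, ENNReal.ofReal (∫ t in (0 : ℝ)..|ξ * X ω|, min 2 t) ∂μ := by
        refine lintegral_mono fun ω => ENNReal.ofReal_le_ofReal ?_
        simpa [mul_assoc] using norm_exp_I_mul_sub_one_sub_le (ξ * X ω)
    _ = ∫⁻ t in Set.Ioi (0 : ℝ), μ {ω | t < |ξ * X ω|} * ENNReal.ofReal (min 2 t) := by
        refine lintegral_comp_eq_lintegral_meas_lt_mul μ (ae_of_all _ fun ω => abs_nonneg _)
          (hX.const_mul ξ).abs.aemeasurable
          (fun t _ => (continuous_const.min continuous_id).intervalIntegrable 0 t) ?_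
        filter_upwards [ae_restrict_mem measurableSet_Ioi] with t ht
        exact le_min zero_le_two (le_of_lt ht)
    _ ≤ ∫⁻ t in Set.Ioi (0 : ℝ), ENNReal.ofReal (K * |ξ| ^ α * (t ^ (-α) * min 2 t)) := by
        refine setLIntegral_mono' measurableSet_Ioi fun t (ht : 0 < t) => ?_
        have hset : {ω | t < |ξ * X ω|} = {ω | t / |ξ| < |X ω|} := by
          ext ω
          simp [abs_mul, div_lt_iff₀' hξ0]
        rw [hset]
        refine (mul_le_mul_left (htail _ (by positivity)) _).trans (le_of_eq ?_)
        rw [← ENNReal.ofReal_mul (by positivity), Real.div_rpow ht.le hξ0.le,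
          Real.rpow_neg hξ0.le, div_inv_eq_mul]
        congr 1
        ring
    _ = ENNReal.ofReal (K * |ξ| ^ α * ∫ t in Set.Ioi (0 : ℝ), t ^ (-α) * min 2 t) := by
        rw [← integral_const_mul, ofReal_integral_eq_lintegral_ofReal
          ((integrableOn_rpow_neg_mul_min hα1 hα2).const_mul _)]
        filter_upwards [ae_restrict_mem measurableSet_Ioi] with t (ht : 0 < t)
        simp only [Pi.zero_apply]
        positivity

theorem measure_lt_abs_le_of_cdf {Ω : Type*} [MeasurableSpace Ω] {μ : Measure Ω}
    [IsProbabilityMeasure μ] {X : Ω → ℝ} (hX : Measurable X) {α c M₁ M₂ : ℝ} {a₁ a₂ : ℝ → ℝ}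
    (ha₁ : ∀ x : ℝ, 0 < x → |a₁ x| ≤ M₁) (ha₂ : ∀ x : ℝ, x < 0 → |a₂ x| ≤ M₂)
    (hpos : ∀ x : ℝ, 0 < x → (μ {ω | X ω ≤ x}).toReal = 1 - (c + a₁ x) / x ^ α)
    (hneg : ∀ x : ℝ, x < 0 → (μ {ω | X ω ≤ x}).toReal = (c + a₂ x) / (-x) ^ α)
    {s : ℝ} (hs : 0 < s) :
    μ {ω | s < |X ω|} ≤ ENNReal.ofReal ((2 * |c| + M₁ + M₂) * s ^ (-α)) := by
  have hright : (μ {ω | s < X ω}).toReal = (c + a₁ s) / s ^ α := by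
    have h := probReal_compl_eq_one_sub (μ := μ)
      (hX measurableSet_Iic : MeasurableSet (X ⁻¹' Set.Iic s))
    have hc : (X ⁻¹' Set.Iic s)ᶜ = {ω | s < X ω} := by ext; simp
    rw [hc] at h
    have h' : (μ {ω | s < X ω}).toReal = 1 - (μ {ω | X ω ≤ s}).toReal := h
    rw [h', hpos s hs]
    ring
  have hleft := hneg (-s) (neg_lt_zero.2 hs)
  rw [neg_neg] at hleft
  have hsub : {ω | s < |X ω|} ⊆ {ω | s < X ω} ∪ {ω | X ω ≤ -s} := by
    intro ω (h : s < |X ω|)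
    rcases lt_abs.1 h with h | h
    · exact Or.inl h
    · exact Or.inr (by simp only [Set.mem_ofPred_eq]; linarith)
  refine ((measure_mono hsub).trans (measure_union_le _ _)).trans ?_
  rw [← ENNReal.ofReal_toReal (measure_ne_top μ {ω | s < X ω}),
    ← ENNReal.ofReal_toReal (measure_ne_top μ {ω | X ω ≤ -s}),
    ← ENNReal.ofReal_add ENNReal.toReal_nonneg ENNReal.toReal_nonneg, hright, hleft,
    ← add_div, div_eq_mul_inv, ← Real.rpow_neg hs.le]
  refine ENNReal.ofReal_le_ofReal (mul_le_mul_of_nonneg_right ?_ (by positivity))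
  have h₁ := (le_abs_self _).trans (ha₁ s hs)
  have h₂ := (le_abs_self _).trans (ha₂ (-s) (neg_lt_zero.2 hs))
  linarith [le_abs_self c]

/-- **Lemma B.6 (`orderN`).** Let `α ∈ (1,2)` and
`c = (1−α)/(2Γ(2−α)cos(πα/2))`. There is a constant `C_α > 0` depending only on `α`
such that for every centered integrable random variable `X` whose distribution
function satisfies `F(x) = 1 − (c + a₁(x))/x^α` for `x > 0` and
`F(x) = (c + a₂(x))/(−x)^α` for `x < 0`, with `a₁, a₂` continuous and bounded (by
`M₁, M₂`) on `(0,∞)` and `(−∞,0)` respectively, one has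
`|φ_X(ξ) − 1| ≤ C_α |ξ|^α (1 + ‖a₁‖_∞ + ‖a₂‖_∞)` for all `ξ ∈ ℝ`. -/
theorem stable_domain_charFun_minus_one_bound (α : ℝ) (hα1 : 1 < α) (hα2 : α < 2) :
    ∃ C > (0 : ℝ),
      ∀ (Ω : Type) (_ : MeasureSpace Ω) (_ : IsProbabilityMeasure (ℙ : Measure Ω))
        (X : Ω → ℝ), Measurable X → Integrable X ℙ → (∫ ω, X ω) = 0 →
        ∀ (a₁ a₂ : ℝ → ℝ) (M₁ M₂ : ℝ),
        ContinuousOn a₁ (Set.Ioi 0) → (∀ x : ℝ, 0 < x → |a₁ x| ≤ M₁) →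
        ContinuousOn a₂ (Set.Iio 0) → (∀ x : ℝ, x < 0 → |a₂ x| ≤ M₂) →
        (∀ x : ℝ, 0 < x → (ℙ {ω | X ω ≤ x}).toReal =
          1 - ((1 - α) / (2 * Real.Gamma (2 - α) * Real.cos (Real.pi * α / 2)) + a₁ x) /
            x ^ α) →
        (∀ x : ℝ, x < 0 → (ℙ {ω | X ω ≤ x}).toReal =
          ((1 - α) / (2 * Real.Gamma (2 - α) * Real.cos (Real.pi * α / 2)) + a₂ x) /
            (-x) ^ α) →
        ∀ ξ : ℝ, ‖(∫ ω, Complex.exp (Complex.I * ξ * X ω)) - 1‖ ≤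
          C * |ξ| ^ α * (1 + M₁ + M₂) := by
  set c := (1 - α) / (2 * Real.Gamma (2 - α) * Real.cos (Real.pi * α / 2))
  set J := ∫ t in Set.Ioi (0 : ℝ), t ^ (-α) * min 2 t
  have hJ : 0 ≤ J :=
    setIntegral_nonneg measurableSet_Ioi fun t (ht : 0 < t) => by positivity
  refine ⟨(2 * |c| + 1) * (J + 1), by positivity, ?_⟩
  intro Ω _ _ X hX hint hmean a₁ a₂ M₁ M₂ _ ha₁ _ ha₂ hpos hneg ξ
  have hM₁ : 0 ≤ M₁ := (abs_nonneg _).trans (ha₁ 1 one_pos)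
  have hM₂ : 0 ≤ M₂ := (abs_nonneg _).trans (ha₂ (-1) (by norm_num))
  refine (norm_integral_exp_sub_one_le_of_tail hint hmean hα1 hα2
    (K := 2 * |c| + M₁ + M₂) (by positivity)
    (fun s hs => measure_lt_abs_le_of_cdf hX ha₁ ha₂ hpos hneg hs) ξ).trans ?_
  have hK : 2 * |c| + M₁ + M₂ ≤ (2 * |c| + 1) * (1 + M₁ + M₂) := by
    nlinarith [mul_nonneg (abs_nonneg c) (add_nonneg hM₁ hM₂)]
  calc (2 * |c| + M₁ + M₂) * |ξ| ^ α * J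
      ≤ (2 * |c| + 1) * (1 + M₁ + M₂) * |ξ| ^ α * (J + 1) := by
        gcongr
        linarith
    _ = (2 * |c| + 1) * (J + 1) * |ξ| ^ α * (1 + M₁ + M₂) := by ring
end
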